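/- Let G with list assignment L and precolored path P be a minimal counterexample configuration for the precolored-path 5-choosability theorem, and let F be the cycle bounding the outer face of G. Let uvw be a 2-chord of F (i.e., a path with u, w on F and v not on F), and let G1, G2 be the two uvw-components of G with P ⊆ G1. Then either u and w are adjacent and G2 is equal to the triangle uvw, or there exists a vertex x such that V(G2) = {u, v, w, x}, |L(x)| = 3, and x is adjacent to u, v and w. -/

import Mathlib

open Set

noncomputable section

/-- A drawing of a simple graph in the plane: vertices are mapped to distinct points,
each edge is realized by a simple arc joining the images of its endpoints, arcs do not
pass through vertex points, any two arcs realizing distinct edges meet in at most one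
point, and no point of the plane that is not a vertex point lies on three or more arcs. -/
structure Drawing {V : Type} (G : SimpleGraph V) where
  pos : V → ℝ × ℝ
  pos_inj : Function.Injective pos
  arc : ∀ ⦃u v : V⦄, G.Adj u v → Path (pos u) (pos v)
  arc_symm : ∀ ⦃u v : V⦄ (h : G.Adj u v), arc h.symm = (arc h).symm
  arc_inj : ∀ ⦃u v : V⦄ (h : G.Adj u v), Function.Injective ⇑(arc h)
  arc_vertex : ∀ ⦃u v : V⦄ (h : G.Adj u v) (t : unitInterval) (w : V),
    arc h t = pos w → t = 0 ∨ t = 1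
  arc_meet_once : ∀ ⦃u v x y : V⦄ (h₁ : G.Adj u v) (h₂ : G.Adj x y),
    s(u, v) ≠ s(x, y) → (Set.range ⇑(arc h₁) ∩ Set.range ⇑(arc h₂)).Subsingleton
  arc_no_triple : ∀ ⦃u₁ v₁ u₂ v₂ u₃ v₃ : V⦄ (h₁ : G.Adj u₁ v₁) (h₂ : G.Adj u₂ v₂)
    (h₃ : G.Adj u₃ v₃), s(u₁, v₁) ≠ s(u₂, v₂) → s(u₁, v₁) ≠ s(u₃, v₃) →
    s(u₂, v₂) ≠ s(u₃, v₃) →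
    ∀ p ∈ Set.range ⇑(arc h₁) ∩ Set.range ⇑(arc h₂) ∩ Set.range ⇑(arc h₃),
      ∃ w : V, p = pos w

namespace Drawing

variable {V : Type} {G : SimpleGraph V} (D : Drawing G)

/-- The set of points used by the arc of an edge. -/
def arcSet ⦃u v : V⦄ (h : G.Adj u v) : Set (ℝ × ℝ) :=
  Set.range ⇑(D.arc h)

/-- The set of interior points of the arc of an edge. -/
def arcInterior ⦃u v : V⦄ (h : G.Adj u v) : Set (ℝ × ℝ) :=
  ⇑(D.arc h) '' {t : unitInterval | t ≠ 0 ∧ t ≠ 1}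

/-- All points of the plane used by the drawing. -/
def graphSet : Set (ℝ × ℝ) :=
  Set.range D.pos ∪ ⋃ (u : V) (v : V) (h : G.Adj u v), D.arcSet h

/-- A crossing of a drawing: a point interior to the arcs of two distinct edges. -/
def IsCrossing (p : ℝ × ℝ) : Prop :=
  ∃ (u v x y : V) (h₁ : G.Adj u v) (h₂ : G.Adj x y),
    s(u, v) ≠ s(x, y) ∧ p ∈ D.arcInterior h₁ ∧ p ∈ D.arcInterior h₂

/-- A drawing is plane if it has no crossings. -/
def IsPlane : Prop := ∀ p : ℝ × ℝ, ¬ D.IsCrossing p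

/-- The faces of a drawing are the connected components of the complement
of the drawing. -/
def IsFace (f : Set (ℝ × ℝ)) : Prop :=
  ∃ q : ℝ × ℝ, q ∉ D.graphSet ∧ f = connectedComponentIn D.graphSetᶜ q

/-- The outer (unbounded) face of a drawing. -/
def outerFace : Set (ℝ × ℝ) :=
  {p : ℝ × ℝ | p ∉ D.graphSet ∧
    ¬ Bornology.IsBounded (connectedComponentIn D.graphSetᶜ p)}

/-- A vertex lies on the outer face if its point is on the boundary of the outer face. -/
def OnOuter (v : V) : Prop := D.pos v ∈ frontier D.outerFace

/-- The set of points of the plane used by the drawing of a walk. -/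
def walkSet {a b : V} (W : G.Walk a b) : Set (ℝ × ℝ) :=
  D.pos '' {v : V | v ∈ W.support} ∪ ⋃ d ∈ W.darts, D.arcSet d.adj

/-- A closed walk bounds the outer face if the boundary of the outer face is exactly
the drawing of the walk. -/
def BoundsOuter {a : V} (W : G.Walk a a) : Prop :=
  frontier D.outerFace = D.walkSet W

end Drawing

/-- The open region enclosed by a set `S` (typically the drawing of a cycle):
all points outside `S` whose connected component in the complement of `S` is bounded. -/
def enclosed (S : Set (ℝ × ℝ)) : Set (ℝ × ℝ) :=
  {p : ℝ × ℝ | p ∉ S ∧ Bornology.IsBounded (connectedComponentIn Sᶜ p)}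

namespace Drawing

variable {V : Type} {G : SimpleGraph V} (D : Drawing G)

/-- The closed disc bounded by (the drawing of) a closed walk. -/
def closedDisc {a : V} (W : G.Walk a a) : Set (ℝ × ℝ) :=
  D.walkSet W ∪ enclosed (D.walkSet W)

/-- The endpoints of the (two) edges incident with a crossing point `p`. -/
def crossingEnds (p : ℝ × ℝ) : Set V :=
  {w : V | ∃ (z : V) (h : G.Adj w z), p ∈ D.arcInterior h}

end Drawing

/-- A proper colouring of `G` from the lists `L`. -/
def IsListColoring {V : Type} (G : SimpleGraph V) (L : V → Finset ℕ) (c : V → ℕ) : Prop :=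
  (∀ v, c v ∈ L v) ∧ ∀ ⦃u v : V⦄, G.Adj u v → c u ≠ c v

/-- `G` is colourable from the lists `L`. -/
def ListColorable {V : Type} (G : SimpleGraph V) (L : V → Finset ℕ) : Prop :=
  ∃ c : V → ℕ, IsListColoring G L c


/-- A counterexample configuration for the precolored-path 5-choosability theorem:
a plane graph `G` (on vertex set `Fin n`), a path `P` of length at most two contained in
the boundary of the outer face, and a list assignment `L` satisfying conditions
(i)–(vi) of the theorem, such that `G` is not `L`-colorable. -/
structure Config where
  n : ℕ
  G : SimpleGraph (Fin n)
  D : Drawing G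
  plane : D.IsPlane
  a : Fin n
  b : Fin n
  P : G.Walk a b
  P_path : P.IsPath
  P_len : P.length ≤ 2
  P_boundary : D.walkSet P ⊆ frontier D.outerFace
  L : Fin n → Finset ℕ
  size5 : ∀ v, ¬ D.OnOuter v → 5 ≤ (L v).card
  size3 : ∀ v, D.OnOuter v → v ∉ P.support → 3 ≤ (L v).card
  size1 : ∀ v ∈ P.support, (L v).card = 1
  no_adjacent_3 : ∀ u v, G.Adj u v → (L u).card = 3 → (L v).card ≠ 3
  proper_on_P : ∀ u ∈ P.support, ∀ v ∈ P.support, G.Adj u v → L u ≠ L v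
  common_neighbor : ∀ p₀ p₁ p₂ : Fin n, P.support = [p₀, p₁, p₂] →
    ∀ x, G.Adj x p₀ → G.Adj x p₁ → G.Adj x p₂ → L x ≠ L p₀ ∪ L p₁ ∪ L p₂
  not_colorable : ¬ ListColorable G L

/-- The number of vertices plus the number of edges of a configuration. -/
def Config.size (C : Config) : ℕ := C.n + C.G.edgeSet.ncard

/-- The length of the precolored path of a configuration. -/
def Config.plen (C : Config) : ℕ := C.P.length

/-- The total size of the lists of a configuration. -/
def Config.lsize (C : Config) : ℕ := ∑ v : Fin C.n, (C.L v).card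

/-- A minimal counterexample configuration: `|V(G)| + |E(G)|` is minimum, subject to
that the precolored path is as long as possible, and subject to that the total size of
the lists is minimum. -/
def Config.Minimal (C : Config) : Prop :=
  (∀ C' : Config, C.size ≤ C'.size) ∧
  (∀ C' : Config, C'.size = C.size → C'.plen ≤ C.plen) ∧
  (∀ C' : Config, C'.size = C.size → C'.plen = C.plen → C.lsize ≤ C'.lsize)

/-- The identification of the plane with `ℂ`. -/
def toC (p : ℝ × ℝ) : ℂ := Complex.equivRealProdCLM.symm p

theorem toC_cont : Continuous toC := Complex.equivRealProdCLM.symm.continuous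

theorem toC_inj : Function.Injective toC := Complex.equivRealProdCLM.symm.injective

/-- `z - p` has a continuous logarithm on `K`. -/
def HasLog (K : Set (ℝ × ℝ)) (p : ℝ × ℝ) : Prop :=
  ∃ g : ℝ × ℝ → ℂ, ContinuousOn g K ∧ ∀ z ∈ K, Complex.exp (g z) = toC z - toC p

/-- The unbounded part of the complement. -/
def extr (K : Set (ℝ × ℝ)) : Set (ℝ × ℝ) :=
  {p | p ∉ K ∧ ¬ Bornology.IsBounded (connectedComponentIn Kᶜ p)}

theorem HasLog.mono {K K' : Set (ℝ × ℝ)} {p : ℝ × ℝ} (h : HasLog K p) (hs : K' ⊆ K) :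
    HasLog K' p := by
  obtain ⟨g, hg, hh⟩ := h
  exact ⟨g, hg.mono hs, fun z hz => hh z (hs hz)⟩

theorem exp_one_const {X : Type*} [TopologicalSpace X] {S : Set X} (hS : IsPreconnected S)
    {f : X → ℂ} (hf : ContinuousOn f S) (h1 : ∀ z ∈ S, Complex.exp (f z) = 1)
    {a b : X} (ha : a ∈ S) (hb : b ∈ S) : f a = f b := by
  have hintg : ∀ z ∈ S, ∃ n : ℤ, f z = n * (2 * Real.pi * Complex.I) := fun z hz =>
    Complex.exp_eq_one_iff.1 (h1 z hz)
  have hpi : (0 : ℝ) < 2 * Real.pi := by positivity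
  let k : X → ℝ := fun z => (f z).im / (2 * Real.pi)
  have hk : ContinuousOn k S := by
    apply ContinuousOn.div_const
    exact Complex.continuous_im.comp_continuousOn hf
  have hkint : ∀ z ∈ S, ∃ n : ℤ, f z = n * (2 * Real.pi * Complex.I) ∧ k z = n := by
    intro z hz
    obtain ⟨n, hn⟩ := hintg z hz
    refine ⟨n, hn, ?_⟩
    simp only [k, hn]
    simp
  have key : ∀ a ∈ S, ∀ b ∈ S, ¬ (k a < k b) := by
    intro a ha b hb hlt
    obtain ⟨n, -, hn⟩ := hkint a ha
    obtain ⟨m, -, hm⟩ := hkint b hb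
    have hnm : n < m := by
      rw [hn, hm] at hlt
      exact_mod_cast hlt
    have : ((n : ℝ) + 1 / 2) ∈ Icc (k a) (k b) := by
      rw [hn, hm]
      have : (n : ℝ) + 1 ≤ m := by exact_mod_cast hnm
      constructor <;> linarith
    obtain ⟨c, hc, hck⟩ := hS.intermediate_value ha hb hk this
    obtain ⟨l, -, hl⟩ := hkint c hc
    rw [hl] at hck
    have h2 : (2 * l : ℝ) = 2 * n + 1 := by linarith
    have h3 : 2 * l = 2 * n + 1 := by exact_mod_cast h2
    omega
  obtain ⟨n, hn, hn'⟩ := hkint a ha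
  obtain ⟨m, hm, hm'⟩ := hkint b hb
  have hab : k a = k b := le_antisymm (not_lt.1 (key b hb a ha)) (not_lt.1 (key a ha b hb))
  rw [hn', hm'] at hab
  have : n = m := by exact_mod_cast hab
  rw [hn, hm, this]

theorem HasLog.glue {K₁ K₂ : Set (ℝ × ℝ)} {p : ℝ × ℝ} (h₁ : HasLog K₁ p) (h₂ : HasLog K₂ p)
    (c₁ : IsClosed K₁) (c₂ : IsClosed K₂) (hc : IsPreconnected (K₁ ∩ K₂)) :
    HasLog (K₁ ∪ K₂) p := by
  classical
  obtain ⟨g₁, hg₁, e₁⟩ := h₁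
  obtain ⟨g₂, hg₂, e₂⟩ := h₂
  have hex : ∃ k : ℂ, Complex.exp k = 1 ∧ ∀ z ∈ K₁ ∩ K₂, g₁ z = g₂ z + k := by
    rcases (K₁ ∩ K₂).eq_empty_or_nonempty with he | ⟨x, hx⟩
    · exact ⟨0, Complex.exp_zero, by simp [he]⟩
    · have h1 : ∀ z ∈ K₁ ∩ K₂, Complex.exp (g₁ z - g₂ z) = 1 := by
        intro z hz
        rw [Complex.exp_sub, e₁ z hz.1, ← e₂ z hz.2, div_self (Complex.exp_ne_zero _)]
      refine ⟨g₁ x - g₂ x, h1 x hx, fun z hz => ?_⟩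
      have := exp_one_const hc (f := fun z => g₁ z - g₂ z)
        ((hg₁.mono inter_subset_left).sub (hg₂.mono inter_subset_right)) h1 hz hx
      rw [← this]; ring
  obtain ⟨k, hk1, hk⟩ := hex
  let g : ℝ × ℝ → ℂ := fun z => if z ∈ K₁ then g₁ z else g₂ z + k
  have hgg1 : ∀ z ∈ K₁, g z = g₁ z := fun z hz => by simp [g, hz]
  have hgg2 : ∀ z ∈ K₂, g z = g₂ z + k := by
    intro z hz
    by_cases h : z ∈ K₁
    · rw [hgg1 z h, hk z ⟨h, hz⟩]
    · simp [g, h]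
  refine ⟨g, ?_, ?_⟩
  · apply ContinuousOn.union_of_isClosed _ _ c₁ c₂
    · exact hg₁.congr hgg1
    · exact (hg₂.add continuousOn_const).congr hgg2
  · rintro z (hz | hz)
    · rw [hgg1 z hz, e₁ z hz]
    · rw [hgg2 z hz, Complex.exp_add, hk1, mul_one, e₂ z hz]

theorem hasLog_near {K : Set (ℝ × ℝ)} {p p' : ℝ × ℝ}
    (h : ∀ z ∈ K, ‖toC p - toC p'‖ < ‖toC z - toC p‖) (hl : HasLog K p) : HasLog K p' := by
  obtain ⟨g, hg, e⟩ := hl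
  have hne : ∀ z ∈ K, toC z - toC p ≠ 0 := fun z hz => by
    have := (norm_nonneg _).trans_lt (h z hz)
    exact norm_pos_iff.1 this
  have hsl : ∀ z ∈ K, 1 + (toC p - toC p') / (toC z - toC p) ∈ Complex.slitPlane := by
    intro z hz
    apply Complex.mem_slitPlane_of_norm_lt_one
    rw [norm_div, div_lt_one (norm_pos_iff.2 (hne z hz))]
    exact h z hz
  refine ⟨fun z => g z + Complex.log (1 + (toC p - toC p') / (toC z - toC p)), ?_, ?_⟩
  · apply hg.add
    apply ContinuousOn.clog _ hsl
    apply continuousOn_const.add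
    apply continuousOn_const.div _ hne
    exact toC_cont.continuousOn.sub continuousOn_const
  · intro z hz
    rw [Complex.exp_add, e z hz, Complex.exp_log (Complex.slitPlane_ne_zero (hsl z hz))]
    have := hne z hz
    field_simp
    ring

/-- Exterior of a Euclidean disc. -/
def farSet (R : ℝ) : Set (ℝ × ℝ) := {p | R < ‖toC p‖}

theorem farSet_preconnected {R : ℝ} (hR : 0 < R) : IsPreconnected (farSet R) := by
  have h1 : IsPreconnected {z : ℂ | Real.log R < z.re} :=
    (convex_halfSpace_re_gt _).isPreconnected
  have h2 := h1.image (fun z => Complex.equivRealProdCLM (Complex.exp z))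
    (Continuous.continuousOn (by fun_prop))
  convert! h2 using 1
  ext p
  simp only [farSet, mem_ofPred_eq, mem_image]
  constructor
  · intro hp
    have hp0 : toC p ≠ 0 := norm_pos_iff.1 (hR.trans hp)
    refine ⟨Complex.log (toC p), ?_, ?_⟩
    · rw [Complex.log_re]; exact Real.log_lt_log hR hp
    · rw [Complex.exp_log hp0]; simp [toC]
  · rintro ⟨z, hz, rfl⟩
    simp only [toC, ContinuousLinearEquiv.symm_apply_apply, Complex.norm_exp]
    rwa [← Real.log_lt_iff_lt_exp hR]

theorem bdd_toC {B : Set (ℝ × ℝ)} (hB : Bornology.IsBounded B) :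
    ∃ R > 0, ∀ p ∈ B, ‖toC p‖ ≤ R := by
  have : Bornology.IsBounded (toC '' B) :=
    Complex.equivRealProdCLM.symm.lipschitz.isBounded_image hB
  obtain ⟨R, hR, h⟩ := this.exists_pos_norm_le
  exact ⟨R, hR, fun p hp => h _ (mem_image_of_mem _ hp)⟩

theorem farSet_unbdd (R : ℝ) : ¬ Bornology.IsBounded (farSet R) := by
  intro h
  obtain ⟨R', hR', h'⟩ := bdd_toC h
  have := h' (Complex.equivRealProdCLM ((max R R' + 1 : ℝ) : ℂ)) (by
    simp only [farSet, mem_ofPred_eq, toC, ContinuousLinearEquiv.symm_apply_apply, Complex.norm_real,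
      Real.norm_eq_abs]
    exact lt_of_lt_of_le (by linarith [le_max_left R R']) (le_abs_self _))
  simp only [toC, ContinuousLinearEquiv.symm_apply_apply, Complex.norm_real,
      Real.norm_eq_abs] at this
  linarith [le_abs_self (max R R' + 1), le_max_right R R']

theorem farSet_subset {K : Set (ℝ × ℝ)} {R : ℝ} (hR : 0 < R) (h : ∀ p ∈ K, ‖toC p‖ ≤ R) :
    farSet R ⊆ extr K := by
  intro p hp
  have hd : farSet R ⊆ Kᶜ := fun q hq hqK => absurd (h q hqK) (not_le.2 hq)
  refine ⟨hd hp, fun hb => farSet_unbdd R (hb.subset ?_)⟩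
  exact (farSet_preconnected hR).subset_connectedComponentIn hp hd

theorem extr_far {K : Set (ℝ × ℝ)} {p : ℝ × ℝ} (hp : p ∈ extr K) (R : ℝ) :
    ∃ y ∈ connectedComponentIn Kᶜ p, y ∈ farSet R := by
  by_contra! hcon
  apply hp.2
  have : connectedComponentIn Kᶜ p ⊆
      Complex.equivRealProdCLM '' (Metric.closedBall 0 R) := by
    intro y hy
    refine ⟨toC y, ?_, by simp [toC]⟩
    have := hcon y hy
    simpa [farSet] using this
  exact (Complex.equivRealProdCLM.lipschitz.isBounded_image Metric.isBounded_closedBall).subset this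

theorem extr_anti {K K' : Set (ℝ × ℝ)} (h : K ⊆ K') : extr K' ⊆ extr K := by
  rintro p ⟨h1, h2⟩
  refine ⟨fun hk => h1 (h hk), fun hb => h2 (hb.subset ?_)⟩
  exact connectedComponentIn_mono p (compl_subset_compl.2 h)

theorem extr_spread {K S : Set (ℝ × ℝ)} (hS : IsPreconnected S) (hd : S ⊆ Kᶜ)
    {x y : ℝ × ℝ} (hx : x ∈ S) (hxe : x ∈ extr K) (hy : y ∈ S) : y ∈ extr K := by
  refine ⟨hd hy, ?_⟩
  have h := hS.subset_connectedComponentIn hx hd hy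
  rw [← connectedComponentIn_eq h]
  exact hxe.2

theorem extr_comp {K : Set (ℝ × ℝ)} {x y : ℝ × ℝ} (hx : x ∈ extr K)
    (hy : y ∈ connectedComponentIn Kᶜ x) : y ∈ extr K :=
  extr_spread isPreconnected_connectedComponentIn (connectedComponentIn_subset _ _)
    (mem_connectedComponentIn hx.1) hx hy

theorem extr_preconnected {K : Set (ℝ × ℝ)} (hK : IsCompact K) : IsPreconnected (extr K) := by
  obtain ⟨R, hR, h⟩ := bdd_toC hK.isBounded
  apply isPreconnected_of_forall_pair
  intro x hx y hy
  obtain ⟨x', hx', hxf⟩ := extr_far hx R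
  obtain ⟨y', hy', hyf⟩ := extr_far hy R
  refine ⟨(connectedComponentIn Kᶜ x ∪ farSet R) ∪ connectedComponentIn Kᶜ y, ?_,
    Or.inl (Or.inl (mem_connectedComponentIn hx.1)), Or.inr (mem_connectedComponentIn hy.1), ?_⟩
  · rintro z ((hz | hz) | hz)
    · exact extr_comp hx hz
    · exact farSet_subset hR h hz
    · exact extr_comp hy hz
  · exact (isPreconnected_connectedComponentIn.union x' hx' hxf (farSet_preconnected hR)).union y'
      (Or.inr hyf) hy' isPreconnected_connectedComponentIn

theorem extr_open {K : Set (ℝ × ℝ)} (hK : IsClosed K) : IsOpen (extr K) := by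
  rw [isOpen_iff_forall_mem_open]
  intro x hx
  exact ⟨_, fun y hy => extr_comp hx hy, hK.isOpen_compl.connectedComponentIn,
    mem_connectedComponentIn hx.1⟩

theorem extr_closure {K : Set (ℝ × ℝ)} (hK : IsClosed K) {x : ℝ × ℝ}
    (hx : x ∈ closure (extr K)) (hxK : x ∉ K) : x ∈ extr K := by
  obtain ⟨y, hy, hye⟩ := mem_closure_iff.1 hx _ hK.isOpen_compl.connectedComponentIn
    (mem_connectedComponentIn (F := Kᶜ) hxK)
  exact extr_spread isPreconnected_connectedComponentIn (connectedComponentIn_subset _ _)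
    hy hye (mem_connectedComponentIn (F := Kᶜ) hxK)

theorem extr_nonempty {K : Set (ℝ × ℝ)} (hK : IsCompact K) (R : ℝ) :
    ∃ x ∈ extr K, x ∈ farSet R := by
  obtain ⟨R', hR, h⟩ := bdd_toC hK.isBounded
  have hne : (farSet (max R R')).Nonempty := by
    rw [nonempty_iff_ne_empty]
    intro he
    exact farSet_unbdd (max R R') (by rw [he]; exact Bornology.isBounded_empty)
  obtain ⟨x, hx⟩ := hne
  exact ⟨x, farSet_subset hR h (lt_of_le_of_lt (le_max_right R R') hx),
    lt_of_le_of_lt (le_max_left R R') hx⟩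

theorem hasLog_far {K : Set (ℝ × ℝ)} {R : ℝ} (hR : 0 < R) (h : ∀ p ∈ K, ‖toC p‖ ≤ R)
    {p : ℝ × ℝ} (hp : p ∈ farSet R) : HasLog K p := by
  have hp0 : toC p ≠ 0 := norm_pos_iff.1 (hR.trans hp)
  have hsl : ∀ z ∈ K, 1 + (- toC z / toC p) ∈ Complex.slitPlane := by
    intro z hz
    apply Complex.mem_slitPlane_of_norm_lt_one
    rw [norm_div, norm_neg, div_lt_one (norm_pos_iff.2 hp0)]
    exact (h z hz).trans_lt hp
  refine ⟨fun z => Complex.log (- toC p) + Complex.log (1 + (- toC z / toC p)), ?_, ?_⟩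
  · apply continuousOn_const.add
    apply ContinuousOn.clog _ hsl
    apply continuousOn_const.add
    exact toC_cont.continuousOn.neg.div_const _
  · intro z hz
    rw [Complex.exp_add, Complex.exp_log (neg_ne_zero.2 hp0),
      Complex.exp_log (Complex.slitPlane_ne_zero (hsl z hz))]
    field_simp
    ring

theorem hasLog_of_extr {K : Set (ℝ × ℝ)} (hK : IsCompact K) {p : ℝ × ℝ} (hp : p ∈ extr K) :
    HasLog K p := by
  obtain ⟨R, hR, h⟩ := bdd_toC hK.isBounded
  obtain ⟨y, hy, hyf⟩ := extr_far hp R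
  have loc : ∀ q ∉ K, ∃ U : Set (ℝ × ℝ), IsOpen U ∧ q ∈ U ∧ ∀ q' ∈ U,
      (HasLog K q ↔ HasLog K q') := by
    intro q hq
    have hcl : IsClosed (toC '' K) := (hK.image toC_cont).isClosed
    have hq' : toC q ∈ (toC '' K)ᶜ := by
      rintro ⟨z, hz, hzq⟩
      exact hq (toC_inj hzq ▸ hz)
    obtain ⟨ε, hε, hb⟩ := Metric.isOpen_iff.1 hcl.isOpen_compl _ hq'
    have hd : ∀ z ∈ K, ε ≤ ‖toC z - toC q‖ := by
      intro z hz
      by_contra! hlt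
      exact hb (by rwa [Metric.mem_ball, dist_eq_norm]) (mem_image_of_mem _ hz)
    refine ⟨{q' | ‖toC q - toC q'‖ < ε / 2}, ?_, by simp [hε], ?_⟩
    · exact isOpen_lt ((continuous_const.sub toC_cont).norm) continuous_const
    · intro q' hq'
      rw [mem_ofPred_eq] at hq'
      constructor
      · apply hasLog_near
        intro z hz
        linarith [hd z hz]
      · apply hasLog_near
        intro z hz
        have h1 := hd z hz
        have h2 : ‖toC z - toC q‖ ≤ ‖toC z - toC q'‖ + ‖toC q - toC q'‖ := by
          have := norm_add_le (toC z - toC q') (toC q' - toC q)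
          rw [norm_sub_rev (toC q) (toC q')]
          simpa using this
        rw [norm_sub_rev (toC q') (toC q)]
        linarith
  have hu : IsOpen {q | q ∉ K ∧ HasLog K q} := by
    rw [isOpen_iff_forall_mem_open]
    rintro q ⟨hq, hql⟩
    obtain ⟨U, hU, hqU, hUl⟩ := loc q hq
    exact ⟨U ∩ Kᶜ, fun q' hq' => ⟨hq'.2, (hUl q' hq'.1).1 hql⟩, hU.inter hK.isClosed.isOpen_compl,
      hqU, hq⟩
  have hv : IsOpen {q | q ∉ K ∧ ¬ HasLog K q} := by
    rw [isOpen_iff_forall_mem_open]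
    rintro q ⟨hq, hql⟩
    obtain ⟨U, hU, hqU, hUl⟩ := loc q hq
    exact ⟨U ∩ Kᶜ, fun q' hq' => ⟨hq'.2, fun hh => hql ((hUl q' hq'.1).2 hh)⟩,
      hU.inter hK.isClosed.isOpen_compl, hqU, hq⟩
  have hsub := IsPreconnected.subset_left_of_subset_union hu hv
    (by
      rw [Set.disjoint_left]
      rintro q ⟨_, h1⟩ ⟨_, h2⟩
      exact h2 h1)
    (s := connectedComponentIn Kᶜ p)
    (by
      intro q hq
      have hqK : q ∉ K := connectedComponentIn_subset _ _ hq
      by_cases hl : HasLog K q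
      · exact Or.inl ⟨hqK, hl⟩
      · exact Or.inr ⟨hqK, hl⟩)
    ⟨y, hy, connectedComponentIn_subset _ _ hy, hasLog_far hR h hyf⟩
    isPreconnected_connectedComponentIn
  exact (hsub (mem_connectedComponentIn hp.1)).2

theorem exists_log_of_contractible {X : Type*} [TopologicalSpace X] [SimplyConnectedSpace X]
    [LocallyPathConnectedSpace X] (h : X → ℂ) (hc : Continuous h) (h0 : ∀ x, h x ≠ 0) :
    ∃ l : X → ℂ, Continuous l ∧ ∀ x, Complex.exp (l x) = h x := by
  obtain ⟨x₀⟩ : Nonempty X := inferInstance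
  obtain ⟨F, ⟨-, hF⟩, -⟩ := Complex.isCoveringMapOn_exp.existsUnique_continuousMap_lifts
    (⟨h, hc⟩ : C(X, ℂ)) (a₀ := x₀) (Complex.exp_log (h0 x₀)) (fun x => h0 x)
  exact ⟨F, F.continuous, fun x => congrFun hF x⟩

theorem extr_of_hasLog {K : Set (ℝ × ℝ)} (hK : IsCompact K) {p : ℝ × ℝ} (hpK : p ∉ K)
    (hl : HasLog K p) : p ∈ extr K := by
  classical
  by_contra hne
  have hb : Bornology.IsBounded (connectedComponentIn Kᶜ p) := by
    by_contra hb
    exact hne ⟨hpK, hb⟩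
  obtain ⟨g, hg, e⟩ := hl
  obtain ⟨G, hG⟩ := ContinuousMap.exists_restrict_eq hK.isClosed
    (⟨K.domRestrict g, continuousOn_iff_continuous_domRestrict.1 hg⟩ : C(K, ℂ))
  have hG' : ∀ z ∈ K, Complex.exp (G z) = toC z - toC p := by
    intro z hz
    rw [← e z hz]
    have := congrArg (fun f : C(K, ℂ) => f ⟨z, hz⟩) hG
    simp at this
    rw [this]
  let W := connectedComponentIn Kᶜ p
  have hWo : IsOpen W := hK.isClosed.isOpen_compl.connectedComponentIn
  have hfr : ∀ z ∈ frontier W, z ∈ K := by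
    intro z hz
    by_contra hzK
    rw [hWo.frontier_eq] at hz
    obtain ⟨y, hy, hyW⟩ := mem_closure_iff.1 hz.1 _ hK.isClosed.isOpen_compl.connectedComponentIn
      (mem_connectedComponentIn (F := Kᶜ) hzK)
    apply hz.2
    have h1 := connectedComponentIn_eq hy
    have h2 := connectedComponentIn_eq hyW
    show z ∈ connectedComponentIn Kᶜ p
    rw [h2, ← h1]
    exact mem_connectedComponentIn (F := Kᶜ) hzK
  let h : ℝ × ℝ → ℂ := W.piecewise (fun z => Complex.exp (G z)) (fun z => toC z - toC p)
  have hc : Continuous h := by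
    apply Continuous.piecewise
    · intro z hz
      exact hG' z (hfr z hz)
    · exact Complex.continuous_exp.comp G.continuous
    · exact toC_cont.sub continuous_const
  have h0 : ∀ z, h z ≠ 0 := by
    intro z
    by_cases hz : z ∈ W
    · simp only [h, Set.piecewise_eq_of_mem _ _ _ hz]
      exact Complex.exp_ne_zero _
    · simp only [h, Set.piecewise_eq_of_notMem _ _ _ hz]
      rw [sub_ne_zero]
      intro hzp
      apply hz
      rw [toC_inj hzp]
      exact mem_connectedComponentIn (F := Kᶜ) hpK
  obtain ⟨l, hlc, hle⟩ := exists_log_of_contractible h hc h0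
  obtain ⟨R, hR, hbR⟩ := bdd_toC hb
  let r : ℝ := R + ‖toC p‖ + 1
  have hr : 0 < r := by positivity
  let γ : ℝ → ℝ × ℝ := fun θ => Complex.equivRealProdCLM (toC p + r * Complex.exp (θ * Complex.I))
  have hγ : Continuous γ := by fun_prop
  have hγC : ∀ θ, toC (γ θ) = toC p + r * Complex.exp (θ * Complex.I) := by
    intro θ; exact Complex.equivRealProdCLM.symm_apply_apply _
  have hhγ : ∀ θ, h (γ θ) = r * Complex.exp (θ * Complex.I) := by
    intro θ
    have hnot : γ θ ∉ W := by
      intro hm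
      have h1 := hbR _ hm
      rw [hγC] at h1
      have h2 : ‖(r : ℂ) * Complex.exp (θ * Complex.I)‖ = r := by
        rw [norm_mul, Complex.norm_exp_ofReal_mul_I, Complex.norm_real, Real.norm_eq_abs,
          abs_of_pos hr, mul_one]
      have h3 := norm_sub_le (toC p + r * Complex.exp (θ * Complex.I)) (toC p)
      rw [add_sub_cancel_left, h2] at h3
      simp only [r] at h3 h1
      linarith
    simp only [h, Set.piecewise_eq_of_notMem _ _ _ hnot]
    rw [hγC]; ring
  have hrC : (r : ℂ) ≠ 0 := by exact_mod_cast hr.ne'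
  have hfin := exp_one_const (S := (univ : Set ℝ)) isPreconnected_univ
    (f := fun θ => l (γ θ) - θ * Complex.I - Complex.log r)
    (by
      apply Continuous.continuousOn
      exact ((hlc.comp hγ).sub (by fun_prop)).sub continuous_const)
    (by
      intro θ _
      rw [Complex.exp_sub, Complex.exp_sub, hle, hhγ, Complex.exp_log hrC]
      have := Complex.exp_ne_zero (θ * Complex.I)
      field_simp)
    (mem_univ (0 : ℝ)) (mem_univ (2 * Real.pi))
  have hper : γ (2 * Real.pi) = γ 0 := by
    simp only [γ]
    congr 3
    push_cast
    rw [Complex.exp_two_pi_mul_I]; simp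
  simp only [hper] at hfin
  have : ((2 * Real.pi : ℝ) : ℂ) * Complex.I = 0 := by
    have h1 := hfin
    push_cast at h1 ⊢
    linear_combination h1
  simp [Real.pi_ne_zero] at this

theorem extr_union {K₁ K₂ : Set (ℝ × ℝ)} (h₁ : IsCompact K₁) (h₂ : IsCompact K₂)
    (hc : IsPreconnected (K₁ ∩ K₂)) {p : ℝ × ℝ} (hp₁ : p ∈ extr K₁) (hp₂ : p ∈ extr K₂) :
    p ∈ extr (K₁ ∪ K₂) :=
  extr_of_hasLog (h₁.union h₂) (by rintro (h | h); exacts [hp₁.1 h, hp₂.1 h])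
    ((hasLog_of_extr h₁ hp₁).glue (hasLog_of_extr h₂ hp₂) h₁.isClosed h₂.isClosed hc)

theorem hasLog_singleton {x p : ℝ × ℝ} (h : x ≠ p) : HasLog {x} p := by
  refine ⟨fun _ => Complex.log (toC x - toC p), continuousOn_const, ?_⟩
  intro z hz
  rw [mem_singleton_iff.1 hz]
  exact Complex.exp_log (sub_ne_zero.2 fun hh => h (toC_inj hh))

theorem extr_union_finite {K T : Set (ℝ × ℝ)} (hK : IsCompact K) (hT : T.Finite) {p : ℝ × ℝ}
    (hp : p ∈ extr K) (hpT : p ∉ T) : p ∈ extr (K ∪ T) := by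
  induction T, hT using Set.Finite.induction_on with
  | empty => simpa using hp
  | @insert a S _ hSf ih =>
    have hpa : a ≠ p := fun h => hpT (h ▸ mem_insert _ _)
    have h1 := ih (fun h => hpT (mem_insert_of_mem _ h))
    have h2 : p ∈ extr {a} := extr_of_hasLog isCompact_singleton
      (fun h => hpa (mem_singleton_iff.1 h).symm) (hasLog_singleton hpa)
    have h3 := extr_union (hK.union hSf.isCompact) isCompact_singleton
      (Set.Subsingleton.isPreconnected
        (Set.subsingleton_singleton.anti (inter_subset_right (s := K ∪ S) (t := {a})))) h1 h2
    have : K ∪ insert a S = K ∪ S ∪ {a} := by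
      ext z; simp only [mem_union, mem_insert_iff, mem_singleton_iff]; tauto
    rwa [this]

theorem exists_log_unit (h : unitInterval → ℂ) (hc : Continuous h) (h0 : ∀ x, h x ≠ 0) :
    ∃ l : unitInterval → ℂ, Continuous l ∧ ∀ x, Complex.exp (l x) = h x := by
  obtain ⟨l, hl, hle⟩ := exists_log_of_contractible
    (fun x : ℝ => h (Set.projIcc 0 1 zero_le_one x)) (hc.comp continuous_projIcc) (fun x => h0 _)
  refine ⟨fun x => l x.1, hl.comp continuous_subtype_val, fun x => ?_⟩
  rw [hle x.1, Set.projIcc_val]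

namespace Drawing

variable {V : Type} {G : SimpleGraph V} (D : Drawing G)

theorem arcSet_symm {u v : V} (h : G.Adj u v) : D.arcSet h.symm = D.arcSet h := by
  simp only [arcSet, D.arc_symm h, Path.symm_range]

theorem arcSet_congr {u v x y : V} (h : G.Adj u v) (h' : G.Adj x y) (e : s(u, v) = s(x, y)) :
    D.arcSet h = D.arcSet h' := by
  rcases Sym2.eq_iff.1 e with ⟨rfl, rfl⟩ | ⟨rfl, rfl⟩
  · rfl
  · exact D.arcSet_symm h'

theorem left_mem {u v : V} (h : G.Adj u v) : D.pos u ∈ D.arcSet h := ⟨0, (D.arc h).source⟩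

theorem right_mem {u v : V} (h : G.Adj u v) : D.pos v ∈ D.arcSet h := ⟨1, (D.arc h).target⟩

theorem arcInterior_subset {u v : V} (h : G.Adj u v) : D.arcInterior h ⊆ D.arcSet h :=
  image_subset_range _ _

theorem arcSet_cases {u v : V} (h : G.Adj u v) {p : ℝ × ℝ} (hp : p ∈ D.arcSet h) :
    p ∈ D.arcInterior h ∨ p = D.pos u ∨ p = D.pos v := by
  obtain ⟨t, rfl⟩ := hp
  by_cases h0 : t = 0
  · right; left; rw [h0]; exact (D.arc h).source
  by_cases h1 : t = 1
  · right; right; rw [h1]; exact (D.arc h).target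
  · left; exact ⟨t, ⟨h0, h1⟩, rfl⟩

theorem pos_notMem_interior {u v : V} (h : G.Adj u v) (w : V) : D.pos w ∉ D.arcInterior h := by
  rintro ⟨t, ⟨h0, h1⟩, ht⟩
  rcases D.arc_vertex h t w ht with h | h
  · exact h0 h
  · exact h1 h

theorem pos_mem_arcSet {u v w : V} (h : G.Adj u v) (hw : D.pos w ∈ D.arcSet h) :
    w = u ∨ w = v := by
  rcases D.arcSet_cases h hw with h' | h' | h'
  · exact absurd h' (D.pos_notMem_interior h w)
  · exact Or.inl (D.pos_inj h')
  · exact Or.inr (D.pos_inj h')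

variable {D}

theorem interior_edge (hD : D.IsPlane) {u v x y : V} {h : G.Adj u v} {h' : G.Adj x y}
    {p : ℝ × ℝ} (hp : p ∈ D.arcInterior h) (hp' : p ∈ D.arcSet h') : s(u, v) = s(x, y) := by
  by_contra hne
  rcases D.arcSet_cases h' hp' with h1 | h1 | h1
  · exact hD p ⟨u, v, x, y, h, h', hne, hp, h1⟩
  · rw [h1] at hp; exact D.pos_notMem_interior h _ hp
  · rw [h1] at hp; exact D.pos_notMem_interior h _ hp

variable (D)

/-- Points of the subgraph with vertex set `X` and edge set `E`. -/
def pts (X : Set V) (E : Set (Sym2 V)) : Set (ℝ × ℝ) :=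
  {p | (∃ x ∈ X, D.pos x = p) ∨ ∃ (u v : V) (h : G.Adj u v), s(u, v) ∈ E ∧ p ∈ D.arcSet h}

theorem pts_mono {X X' : Set V} {E E' : Set (Sym2 V)} (hX : X ⊆ X') (hE : E ⊆ E') :
    D.pts X E ⊆ D.pts X' E' := by
  rintro p (⟨x, hx, rfl⟩ | ⟨u, v, h, he, hp⟩)
  · exact Or.inl ⟨x, hX hx, rfl⟩
  · exact Or.inr ⟨u, v, h, hE he, hp⟩

theorem pts_subset_graphSet (X : Set V) (E : Set (Sym2 V)) : D.pts X E ⊆ D.graphSet := by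
  rintro p (⟨x, hx, rfl⟩ | ⟨u, v, h, he, hp⟩)
  · exact Or.inl (mem_range_self x)
  · refine Or.inr ?_
    simp only [mem_iUnion]
    exact ⟨u, v, h, hp⟩

theorem graphSet_eq : D.graphSet = D.pts univ univ := by
  apply Subset.antisymm _ (D.pts_subset_graphSet _ _)
  rintro p (⟨x, rfl⟩ | h)
  · exact Or.inl ⟨x, mem_univ _, rfl⟩
  · simp only [mem_iUnion] at h
    obtain ⟨u, v, h, hp⟩ := h
    exact Or.inr ⟨u, v, h, mem_univ _, hp⟩

theorem walkSet_eq {a b : V} (W : G.Walk a b) :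
    D.walkSet W = D.pts {x | x ∈ W.support} {e | e ∈ W.edges} := by
  ext p
  constructor
  · rintro (⟨x, hx, rfl⟩ | h)
    · exact Or.inl ⟨x, hx, rfl⟩
    · simp only [mem_iUnion] at h
      obtain ⟨d, hd, hp⟩ := h
      have hde : d.edge ∈ W.edges := List.mem_map.2 ⟨d, hd, rfl⟩
      exact Or.inr ⟨d.fst, d.snd, d.adj, hde, hp⟩
  · rintro (⟨x, hx, rfl⟩ | ⟨u, v, h, he, hp⟩)
    · exact Or.inl ⟨x, hx, rfl⟩
    · refine Or.inr ?_
      obtain ⟨d, hd, hde⟩ := List.mem_map.1 he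
      simp only [mem_iUnion]
      refine ⟨d, hd, ?_⟩
      rw [D.arcSet_congr d.adj h hde]
      exact hp

theorem arcSet_subset_pts {X : Set V} {E : Set (Sym2 V)} {u v : V} (h : G.Adj u v)
    (he : s(u, v) ∈ E) : D.arcSet h ⊆ D.pts X E := fun _ hp => Or.inr ⟨u, v, h, he, hp⟩

/-- Edges in `E` have their ends in `X`. -/
def Sat (X : Set V) (E : Set (Sym2 V)) : Prop := ∀ e ∈ E, ∀ x ∈ e, x ∈ X

theorem walk_sat {a b : V} (W : G.Walk a b) : Sat {x | x ∈ W.support} {e | e ∈ W.edges} :=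
  fun _ he _ hx => SimpleGraph.Walk.mem_support_of_mem_edges he hx

variable {D}

theorem pos_mem_pts {X : Set V} {E : Set (Sym2 V)} (hs : Sat X E) {w : V}
    (hw : D.pos w ∈ D.pts X E) : w ∈ X := by
  rcases hw with ⟨x, hx, he⟩ | ⟨u, v, h, he, hp⟩
  · rwa [← D.pos_inj he]
  · rcases D.pos_mem_arcSet h hp with rfl | rfl
    · exact hs _ he _ (Sym2.mem_mk_left _ _)
    · exact hs _ he _ (Sym2.mem_mk_right _ _)

theorem interior_mem_pts (hD : D.IsPlane) {X : Set V} {E : Set (Sym2 V)} {u v : V}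
    {h : G.Adj u v} {p : ℝ × ℝ} (hp : p ∈ D.arcInterior h) (hpt : p ∈ D.pts X E) :
    s(u, v) ∈ E := by
  rcases hpt with ⟨x, hx, rfl⟩ | ⟨x, y, h', he, hp'⟩
  · exact absurd hp (D.pos_notMem_interior h x)
  · rwa [interior_edge hD hp hp']

theorem pts_inter (hD : D.IsPlane) {X₁ X₂ : Set V} {E₁ E₂ : Set (Sym2 V)} (h₁ : Sat X₁ E₁)
    (h₂ : Sat X₂ E₂) : D.pts X₁ E₁ ∩ D.pts X₂ E₂ = D.pts (X₁ ∩ X₂) (E₁ ∩ E₂) := by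
  apply Subset.antisymm
  · rintro p ⟨hp1, hp2⟩
    have hv : ∀ x, D.pos x = p → p ∈ D.pts (X₁ ∩ X₂) (E₁ ∩ E₂) := by
      rintro x rfl
      exact Or.inl ⟨x, ⟨pos_mem_pts h₁ hp1, pos_mem_pts h₂ hp2⟩, rfl⟩
    rcases hp1 with ⟨x, hx, he⟩ | ⟨u, v, h, he, hp⟩
    · exact hv x he
    · rcases D.arcSet_cases h hp with h' | h' | h'
      · exact Or.inr ⟨u, v, h, ⟨he, interior_mem_pts hD h' hp2⟩, hp⟩
      · exact hv u h'.symm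
      · exact hv v h'.symm
  · exact subset_inter (D.pts_mono inter_subset_left inter_subset_left)
      (D.pts_mono inter_subset_right inter_subset_right)

variable (D)

theorem arcSet_compact {u v : V} (h : G.Adj u v) : IsCompact (D.arcSet h) :=
  isCompact_range (D.arc h).continuous

theorem pts_compact [Finite V] (X : Set V) (E : Set (Sym2 V)) : IsCompact (D.pts X E) := by
  have : D.pts X E = D.pos '' X ∪ ⋃ (u : V) (v : V) (h : {_h : G.Adj u v // s(u, v) ∈ E}),
      D.arcSet h.1 := by
    ext p
    simp only [pts, mem_ofPred_eq, mem_union, mem_image, mem_iUnion]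
    constructor
    · rintro (h | ⟨a, b, h, he, hp⟩)
      · exact Or.inl h
      · exact Or.inr ⟨a, b, ⟨h, he⟩, hp⟩
    · rintro (h | ⟨a, b, ⟨h, he⟩, hp⟩)
      · exact Or.inl h
      · exact Or.inr ⟨a, b, h, he, hp⟩
  rw [this]
  apply ((Set.toFinite X).image _).isCompact.union
  refine isCompact_iUnion fun u => isCompact_iUnion fun v => isCompact_iUnion fun h => ?_
  exact D.arcSet_compact h.1

theorem graphSet_compact [Finite V] : IsCompact D.graphSet := by
  rw [graphSet_eq]; exact D.pts_compact _ _

theorem interior_eq {u v : V} (h : G.Adj u v) :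
    D.arcInterior h = ⇑(D.arc h) '' Ioo 0 1 := by
  unfold arcInterior
  congr 1
  ext t
  simp only [mem_ofPred_eq, mem_Ioo]
  exact ⟨fun h => ⟨unitInterval.pos_iff_ne_zero.2 h.1, unitInterval.lt_one_iff_ne_one.2 h.2⟩,
    fun h => ⟨unitInterval.pos_iff_ne_zero.1 h.1, unitInterval.lt_one_iff_ne_one.1 h.2⟩⟩

theorem interior_preconnected {u v : V} (h : G.Adj u v) : IsPreconnected (D.arcInterior h) := by
  rw [interior_eq]
  exact isPreconnected_Ioo.image _ (D.arc h).continuous.continuousOn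

theorem arcSet_subset_closure {u v : V} (h : G.Adj u v) :
    D.arcSet h ⊆ closure (D.arcInterior h) := by
  rw [interior_eq]
  have h1 : closure (Ioo (0 : unitInterval) 1) = Icc 0 1 := closure_Ioo (by simp)
  rintro p ⟨t, rfl⟩
  apply image_closure_subset_closure_image (D.arc h).continuous
  exact mem_image_of_mem _ (by rw [h1]; exact ⟨unitInterval.nonneg', unitInterval.le_one'⟩)

theorem interior_nonempty {u v : V} (h : G.Adj u v) : (D.arcInterior h).Nonempty := by
  rw [interior_eq]
  exact (nonempty_Ioo.2 (by simp)).image _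

variable {D}

theorem edge_in [Finite V] (hD : D.IsPlane) {X : Set V} {E : Set (Sym2 V)} {u v : V}
    (h : G.Adj u v) {m : ℝ × ℝ} (hm : m ∈ D.arcInterior h) (hme : m ∉ extr (D.pts X E)) :
    D.arcSet h ⊆ (extr (D.pts X E))ᶜ := by
  by_cases he : s(u, v) ∈ E
  · intro p hp hpe
    exact hpe.1 (D.arcSet_subset_pts h he hp)
  · have hd : D.arcInterior h ⊆ (D.pts X E)ᶜ := fun p hp hpt => he (interior_mem_pts hD hp hpt)
    have h1 : D.arcInterior h ⊆ (extr (D.pts X E))ᶜ := fun p hp hpe =>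
      hme (extr_spread (D.interior_preconnected h) hd hp hpe hm)
    refine (D.arcSet_subset_closure h).trans (closure_minimal h1 ?_)
    exact (extr_open (D.pts_compact X E).isClosed).isClosed_compl

theorem edge_in_of_vertex [Finite V] (hD : D.IsPlane) {X : Set V} {E : Set (Sym2 V)} {u v : V}
    (h : G.Adj u v) (hu : D.pos u ∉ D.pts X E) (hue : D.pos u ∉ extr (D.pts X E)) :
    D.arcSet h ⊆ (extr (D.pts X E))ᶜ := by
  by_cases hex : ∃ m ∈ D.arcInterior h, m ∉ extr (D.pts X E)
  · obtain ⟨m, hm, hme⟩ := hex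
    exact edge_in hD h hm hme
  · push Not at hex
    exact absurd (extr_closure (D.pts_compact X E).isClosed
      (closure_mono hex (D.arcSet_subset_closure h (D.left_mem h))) hu) hue

theorem edge_split [Finite V] (hD : D.IsPlane) {X₁ X₂ : Set V} {E₁ E₂ : Set (Sym2 V)}
    {K : Set (ℝ × ℝ)} (hK : K ⊆ D.pts X₁ E₁ ∪ D.pts X₂ E₂)
    (hc : IsPreconnected (D.pts X₁ E₁ ∩ D.pts X₂ E₂)) {u v : V} (h : G.Adj u v)
    (hin : D.arcSet h ⊆ (extr K)ᶜ) :
    D.arcSet h ⊆ (extr (D.pts X₁ E₁))ᶜ ∨ D.arcSet h ⊆ (extr (D.pts X₂ E₂))ᶜ := by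
  obtain ⟨m, hm⟩ := D.interior_nonempty h
  by_cases h1 : m ∈ extr (D.pts X₁ E₁)
  · by_cases h2 : m ∈ extr (D.pts X₂ E₂)
    · exact absurd (extr_anti hK (extr_union (D.pts_compact _ _) (D.pts_compact _ _) hc h1 h2))
        (hin (D.arcInterior_subset h hm))
    · exact Or.inr (edge_in hD h hm h2)
  · exact Or.inl (edge_in hD h hm h1)

theorem vertex_split [Finite V] {X₁ X₂ : Set V} {E₁ E₂ : Set (Sym2 V)}
    {K : Set (ℝ × ℝ)} (hK : K ⊆ D.pts X₁ E₁ ∪ D.pts X₂ E₂)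
    (hc : IsPreconnected (D.pts X₁ E₁ ∩ D.pts X₂ E₂)) {m : ℝ × ℝ} (hin : m ∉ extr K) :
    m ∉ extr (D.pts X₁ E₁) ∨ m ∉ extr (D.pts X₂ E₂) := by
  by_contra! hcon
  exact hin (extr_anti hK (extr_union (D.pts_compact _ _) (D.pts_compact _ _) hc hcon.1 hcon.2))

theorem outer_not_in {X : Set V} {E : Set (Sym2 V)} [Finite V] {q : ℝ × ℝ}
    (hq : q ∈ frontier D.outerFace) (hqK : q ∉ D.pts X E) : q ∈ extr (D.pts X E) := by
  apply extr_closure (D.pts_compact X E).isClosed _ hqK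
  exact closure_mono (extr_anti (D.pts_subset_graphSet X E)) hq.1

theorem graph_in_F [Finite V] {a : V} {F : G.Walk a a} (hF : D.BoundsOuter F) {p : ℝ × ℝ}
    (hp : p ∈ D.graphSet) : p ∉ extr (D.walkSet F) := by
  intro hpe
  have hFs : D.walkSet F ⊆ D.graphSet := by
    rw [walkSet_eq]; exact D.pts_subset_graphSet _ _
  have hFc : IsCompact (D.walkSet F) := by rw [walkSet_eq]; exact D.pts_compact _ _
  have hopen : IsOpen D.outerFace := extr_open D.graphSet_compact.isClosed
  have hsub : extr (D.walkSet F) ⊆ D.outerFace := by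
    apply (extr_preconnected hFc).subset_of_closure_inter_subset hopen
    · obtain ⟨x, hx, -⟩ := extr_nonempty D.graphSet_compact 0
      exact ⟨x, extr_anti hFs hx, hx⟩
    · rintro q ⟨hq1, hq2⟩
      by_contra hq
      have : q ∈ frontier D.outerFace := by rw [hopen.frontier_eq]; exact ⟨hq1, hq⟩
      rw [hF] at this
      exact hq2.1 this
  exact (hsub hpe).1 hp

variable (D)

theorem hasLog_arc {u v : V} (h : G.Adj u v) {p : ℝ × ℝ} (hp : p ∉ D.arcSet h) :
    HasLog (D.arcSet h) p := by
  obtain ⟨l, hl, hle⟩ := exists_log_unit (fun t => toC (D.arc h t) - toC p)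
    ((toC_cont.comp (D.arc h).continuous).sub continuous_const)
    (fun t => sub_ne_zero.2 fun hh => hp ⟨t, toC_inj hh⟩)
  have hemb : Topology.IsClosedEmbedding ⇑(D.arc h) :=
    (D.arc h).continuous.isClosedEmbedding (D.arc_inj h)
  refine ⟨fun z => l (Function.invFun (D.arc h) z), ?_, ?_⟩
  · rw [continuousOn_iff_continuous_domRestrict]
    let e := hemb.isEmbedding.toHomeomorph
    have : (D.arcSet h).domRestrict (fun z => l (Function.invFun (D.arc h) z)) =
        fun z => l (e.symm z) := by
      funext z
      obtain ⟨t, rfl⟩ := e.surjective z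
      simp only [Homeomorph.symm_apply_apply]
      exact congrArg l (Function.leftInverse_invFun (D.arc_inj h) t)
    rw [this]
    exact hl.comp e.symm.continuous
  · rintro z ⟨t, rfl⟩
    simp only
    rw [Function.leftInverse_invFun (D.arc_inj h) t]
    exact hle t

variable {D}

theorem walkSet_cons {u v w : V} (h : G.Adj u v) (W : G.Walk v w) :
    D.walkSet (SimpleGraph.Walk.cons h W) = D.arcSet h ∪ D.walkSet W := by
  rw [walkSet_eq, walkSet_eq]
  ext p
  constructor
  · rintro (⟨x, hx, rfl⟩ | ⟨a, b, h', he, hp⟩)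
    · rcases List.mem_cons.1 hx with rfl | hx
      · exact Or.inl (D.left_mem h)
      · exact Or.inr (Or.inl ⟨x, hx, rfl⟩)
    · rcases List.mem_cons.1 he with he | he
      · left; rwa [D.arcSet_congr h h' he.symm]
      · exact Or.inr (Or.inr ⟨a, b, h', he, hp⟩)
  · rintro (hp | hp)
    · exact Or.inr ⟨u, v, h, by simp, hp⟩
    · exact D.pts_mono (fun x hx => by simp only [mem_ofPred_eq] at hx ⊢; simp [hx])
        (fun x hx => by simp only [mem_ofPred_eq] at hx ⊢; simp [hx]) hp

theorem walkSet_compact [Finite V] {u v : V} (W : G.Walk u v) : IsCompact (D.walkSet W) := by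
  rw [walkSet_eq]; exact D.pts_compact _ _

theorem arc_inter_walk (hD : D.IsPlane) {u v a b : V} (h : G.Adj u v) (W : G.Walk a b)
    (he : s(u, v) ∉ W.edges) {p : ℝ × ℝ} (hp : p ∈ D.arcSet h) (hpW : p ∈ D.walkSet W) :
    (p = D.pos u ∧ u ∈ W.support) ∨ (p = D.pos v ∧ v ∈ W.support) := by
  rw [walkSet_eq] at hpW
  rcases D.arcSet_cases h hp with h1 | rfl | rfl
  · exact absurd (interior_mem_pts hD h1 hpW) he
  · exact Or.inl ⟨rfl, pos_mem_pts (walk_sat W) hpW⟩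
  · exact Or.inr ⟨rfl, pos_mem_pts (walk_sat W) hpW⟩

theorem hasLog_walk [Finite V] (hD : D.IsPlane) {u v : V} (W : G.Walk u v) (hW : W.IsPath)
    {p : ℝ × ℝ} (hp : p ∉ D.walkSet W) : HasLog (D.walkSet W) p := by
  induction W with
  | nil =>
    rename_i u
    have hs : D.walkSet (SimpleGraph.Walk.nil : G.Walk u u) = {D.pos u} := by
      ext z; simp [walkSet]
    rw [hs] at hp ⊢
    exact hasLog_singleton fun h => hp h.symm
  | cons h W ih =>
    rename_i u v w
    rw [SimpleGraph.Walk.cons_isPath_iff] at hW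
    rw [walkSet_cons] at hp ⊢
    refine (D.hasLog_arc h fun hh => hp (Or.inl hh)).glue (ih hW.1 fun hh => hp (Or.inr hh))
      (D.arcSet_compact h).isClosed (walkSet_compact W).isClosed ?_
    apply Set.Subsingleton.isPreconnected
    have : ∀ z ∈ D.arcSet h ∩ D.walkSet W, z = D.pos v := by
      rintro z ⟨h1, h2⟩
      rcases arc_inter_walk hD h W
        (fun he => hW.2 (W.fst_mem_support_of_mem_edges he)) h1 h2 with h3 | h3
      · exact absurd h3.2 hW.2
      · exact h3.1
    intro x hx y hy
    rw [this x hx, this y hy]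

theorem arc_frontier [Finite V] (hD : D.IsPlane) {a b : V} (h : G.Adj a b) (W : G.Walk a b)
    (hW : W.IsPath) (he : s(a, b) ∉ W.edges) :
    D.arcSet h ⊆ closure (extr (D.arcSet h ∪ D.walkSet W)) := by
  refine (D.arcSet_subset_closure h).trans (closure_minimal ?_ isClosed_closure)
  rw [interior_eq]
  rintro q ⟨t₀, ht₀, rfl⟩
  by_contra hq
  set K := D.arcSet h ∪ D.walkSet W with hKdef
  have hKc : IsCompact K := (D.arcSet_compact h).union (walkSet_compact W)
  have hnh : ⇑(D.arc h) ⁻¹' (closure (extr K))ᶜ ∈ nhds t₀ :=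
    (D.arc h).continuous.continuousAt.preimage_mem_nhds (isClosed_closure.isOpen_compl.mem_nhds hq)
  obtain ⟨s, t, hst, hsub⟩ := (mem_nhds_iff_exists_Ioo_subset' ⟨0, ht₀.1⟩ ⟨1, ht₀.2⟩).1 hnh
  set A₁ := ⇑(D.arc h) '' Iic s with hA₁
  set A₂ := ⇑(D.arc h) '' Ici t with hA₂
  have hA₁c : IsCompact A₁ := isClosed_Iic.isCompact.image (D.arc h).continuous
  have hA₂c : IsCompact A₂ := isClosed_Ici.isCompact.image (D.arc h).continuous
  have hA₁s : A₁ ⊆ D.arcSet h := image_subset_range _ _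
  have hA₂s : A₂ ⊆ D.arcSet h := image_subset_range _ _
  have hWc : IsCompact (D.walkSet W) := walkSet_compact W
  have hbA₁ : D.pos b ∉ A₁ := by
    rintro ⟨r, hr, hrb⟩
    have : r = 1 := D.arc_inj h (hrb.trans (D.arc h).target.symm)
    rw [this] at hr
    exact absurd (lt_of_lt_of_le (hst.1.trans hst.2) (unitInterval.le_one' (t := t)))
      (not_lt.2 hr)
  have haA₂ : D.pos a ∉ A₂ := by
    rintro ⟨r, hr, hrb⟩
    have : r = 0 := D.arc_inj h (hrb.trans (D.arc h).source.symm)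
    rw [this] at hr
    exact absurd (lt_of_le_of_lt (unitInterval.nonneg' (t := s)) (hst.1.trans hst.2))
      (not_lt.2 hr)
  have hAA : ∀ z ∈ A₁, z ∉ A₂ := by
    rintro z ⟨r, hr, rfl⟩ ⟨r', hr', hrr⟩
    have := D.arc_inj h hrr
    rw [this] at hr'
    exact absurd (hst.1.trans hst.2) (not_lt.2 (le_trans hr' hr))
  set J := (D.walkSet W ∪ A₁) ∪ A₂ with hJ
  have hJc : IsCompact J := (hWc.union hA₁c).union hA₂c
  have hJK : J ⊆ K := by
    rintro z ((hz | hz) | hz)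
    · exact Or.inr hz
    · exact Or.inl (hA₁s hz)
    · exact Or.inl (hA₂s hz)
  have hlog : ∀ p, p ∉ J → p ∈ extr J := by
    intro p hp
    have hpW : p ∉ D.walkSet W := fun hh => hp (Or.inl (Or.inl hh))
    have hp1 : p ∉ A₁ := fun hh => hp (Or.inl (Or.inr hh))
    have hp2 : p ∉ A₂ := fun hh => hp (Or.inr hh)
    -- the pieces of the arc separately
    have hsubarc : ∀ S : Set unitInterval, ∀ c d : unitInterval, S = Icc c d →
        p ∉ ⇑(D.arc h) '' S → HasLog (⇑(D.arc h) '' S) p := by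
      rintro S c d rfl hpS
      have hemb : Topology.IsClosedEmbedding ⇑(D.arc h) :=
        (D.arc h).continuous.isClosedEmbedding (D.arc_inj h)
      by_cases hcd : c ≤ d
      · let pr : unitInterval → unitInterval := fun x => max c (min d x)
        have hpr : Continuous pr := by fun_prop
        have hpr1 : ∀ x, pr x ∈ Icc c d := fun x =>
          ⟨le_max_left _ _, max_le hcd (min_le_left _ _)⟩
        have hpr2 : ∀ x ∈ Icc c d, pr x = x := fun x hx => by
          simp only [pr]; rw [min_eq_right hx.2, max_eq_right hx.1]
        obtain ⟨l, hl, hle⟩ := exists_log_unit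
          (fun x => toC (D.arc h (pr x)) - toC p)
          ((toC_cont.comp ((D.arc h).continuous.comp hpr)).sub continuous_const)
          (fun x => sub_ne_zero.2 fun hh => hpS ⟨pr x, hpr1 x, toC_inj hh⟩)
        let e := hemb.isEmbedding.toHomeomorph
        have hco : ContinuousOn (fun z => l (Function.invFun (D.arc h) z)) (D.arcSet h) := by
          rw [continuousOn_iff_continuous_domRestrict]
          have : (D.arcSet h).domRestrict (fun z => l (Function.invFun (D.arc h) z)) =
              fun z => l (e.symm z) := by
            funext z
            obtain ⟨x, rfl⟩ := e.surjective z
            simp only [Homeomorph.symm_apply_apply]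
            exact congrArg l (Function.leftInverse_invFun (D.arc_inj h) x)
          rw [this]
          exact hl.comp e.symm.continuous
        refine ⟨_, hco.mono (image_subset_range _ _), ?_⟩
        rintro z ⟨x, hx, rfl⟩
        rw [Function.leftInverse_invFun (D.arc_inj h) x, hle x, hpr2 x hx]
      · rw [Icc_eq_empty hcd, image_empty]
        exact ⟨fun _ => 0, continuousOn_empty _, by simp⟩
    have hl1 := hsubarc (Iic s) 0 s (by
      ext x; simp [unitInterval.nonneg']) hp1
    have hl2 := hsubarc (Ici t) t 1 (by
      ext x; simp [unitInterval.le_one']) hp2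
    apply extr_of_hasLog hJc hp
    refine ((hasLog_walk hD W hW hpW).glue hl1 hWc.isClosed hA₁c.isClosed ?_).glue hl2
      (hWc.union hA₁c).isClosed hA₂c.isClosed ?_
    · apply Set.Subsingleton.isPreconnected
      have : ∀ z ∈ D.walkSet W ∩ A₁, z = D.pos a := by
        rintro z ⟨h1, h2⟩
        rcases arc_inter_walk hD h W he (hA₁s h2) h1 with h3 | h3
        · exact h3.1
        · exact absurd (h3.1 ▸ h2) hbA₁
      intro x hx y hy
      rw [this x hx, this y hy]
    · apply Set.Subsingleton.isPreconnected
      have : ∀ z ∈ (D.walkSet W ∪ A₁) ∩ A₂, z = D.pos b := by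
        rintro z ⟨h1 | h1, h2⟩
        · rcases arc_inter_walk hD h W he (hA₂s h2) h1 with h3 | h3
          · exact absurd (h3.1 ▸ h2) haA₂
          · exact h3.1
        · exact absurd h2 (hAA z h1)
      intro x hx y hy
      rw [this x hx, this y hy]
  have hq₀ : D.arc h t₀ ∉ J := by
    rintro ((hz | ⟨r, hr, hz⟩) | ⟨r, hr, hz⟩)
    · rw [walkSet_eq] at hz
      refine he (interior_mem_pts hD (h := h) ?_ hz)
      rw [interior_eq]; exact mem_image_of_mem _ ht₀
    · rw [D.arc_inj h hz] at hr; exact absurd hst.1 (not_lt.2 hr)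
    · rw [D.arc_inj h hz] at hr; exact absurd hst.2 (not_lt.2 hr)
  have hfin : extr J ⊆ extr K := by
    apply (extr_preconnected hJc).subset_of_closure_inter_subset (extr_open hKc.isClosed)
    · obtain ⟨x, hx, -⟩ := extr_nonempty hKc 0
      exact ⟨x, extr_anti hJK hx, hx⟩
    · rintro z ⟨hz1, hz2⟩
      apply extr_closure hKc.isClosed hz1
      rintro (⟨r, rfl⟩ | hz)
      · by_cases h1 : r ≤ s
        · exact hz2.1 (Or.inl (Or.inr ⟨r, h1, rfl⟩))
        · by_cases h2 : t ≤ r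
          · exact hz2.1 (Or.inr ⟨r, h2, rfl⟩)
          · exact hsub ⟨not_le.1 h1, not_le.1 h2⟩ hz1
      · exact hz2.1 (Or.inl (Or.inl hz))
  exact (hfin (hlog _ hq₀)).1 (Or.inl ⟨t₀, rfl⟩)

end Drawing

theorem mem_frontier_of {S : Set (ℝ × ℝ)} {q : ℝ × ℝ} (h : q ∈ closure S) (h' : q ∉ S) :
    q ∈ frontier S := ⟨h, fun hi => h' (interior_subset hi)⟩

theorem frontier_extr_mono {K K' : Set (ℝ × ℝ)} (hs : K' ⊆ K) {q : ℝ × ℝ}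
    (hq : q ∈ frontier (extr K)) (hq' : q ∈ K') : q ∈ frontier (extr K') :=
  mem_frontier_of (closure_mono (extr_anti hs) hq.1) fun h => h.1 hq'

namespace Drawing

variable {V : Type} {G : SimpleGraph V} (D : Drawing G)

/-- The drawing of a spanning subgraph. -/
def restrict {G' : SimpleGraph V} (hle : G' ≤ G) : Drawing G' where
  pos := D.pos
  pos_inj := D.pos_inj
  arc := fun _ _ h => D.arc (hle h)
  arc_symm := fun _ _ h => D.arc_symm (hle h)
  arc_inj := fun _ _ h => D.arc_inj (hle h)
  arc_vertex := fun _ _ h => D.arc_vertex (hle h)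
  arc_meet_once := fun _ _ _ _ h₁ h₂ => D.arc_meet_once (hle h₁) (hle h₂)
  arc_no_triple := fun _ _ _ _ _ _ h₁ h₂ h₃ => D.arc_no_triple (hle h₁) (hle h₂) (hle h₃)

theorem restrict_plane {G' : SimpleGraph V} (hle : G' ≤ G) (hD : D.IsPlane) :
    (D.restrict hle).IsPlane := by
  rintro p ⟨u, v, x, y, h₁, h₂, hne, hp₁, hp₂⟩
  exact hD p ⟨u, v, x, y, hle h₁, hle h₂, hne, hp₁, hp₂⟩

theorem restrict_graphSet {G' : SimpleGraph V} (hle : G' ≤ G) :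
    (D.restrict hle).graphSet ⊆ D.graphSet := by
  rw [graphSet_eq, graphSet_eq]
  rintro p (⟨x, hx, rfl⟩ | ⟨u, v, h, he, hp⟩)
  · exact Or.inl ⟨x, hx, rfl⟩
  · exact Or.inr ⟨u, v, hle h, he, hp⟩

theorem restrict_onOuter {G' : SimpleGraph V} (hle : G' ≤ G) {v : V} (h : D.OnOuter v) :
    (D.restrict hle).OnOuter v :=
  frontier_extr_mono (D.restrict_graphSet hle) h (Or.inl ⟨v, rfl⟩)

/-- The drawing of an induced subgraph. -/
def pullback {V' : Type} (f : V' → V) (hf : Function.Injective f) : Drawing (G.comap f) where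
  pos := fun x => D.pos (f x)
  pos_inj := D.pos_inj.comp hf
  arc := fun u v h => D.arc (u := f u) (v := f v) h
  arc_symm := fun u v h => D.arc_symm (u := f u) (v := f v) h
  arc_inj := fun u v h => D.arc_inj (u := f u) (v := f v) h
  arc_vertex := fun u v h t w => D.arc_vertex (u := f u) (v := f v) h t (f w)
  arc_meet_once := fun u v x y h₁ h₂ hne => D.arc_meet_once (u := f u) (v := f v) h₁ h₂
    (fun e => hne (Sym2.map.injective hf e))
  arc_no_triple := fun u₁ v₁ u₂ v₂ u₃ v₃ h₁ h₂ h₃ n₁ n₂ n₃ p hp => by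
    obtain ⟨w, hw⟩ := D.arc_no_triple (u₁ := f u₁) (v₁ := f v₁) h₁ h₂ h₃
      (fun e => n₁ (Sym2.map.injective hf e)) (fun e => n₂ (Sym2.map.injective hf e))
      (fun e => n₃ (Sym2.map.injective hf e)) p hp
    have h1 : p ∈ D.arcSet (u := f u₁) (v := f v₁) h₁ := hp.1.1
    rw [hw] at h1
    rcases D.pos_mem_arcSet _ h1 with rfl | rfl
    · exact ⟨u₁, hw⟩
    · exact ⟨v₁, hw⟩

theorem pullback_plane {V' : Type} (f : V' → V) (hf : Function.Injective f) (hD : D.IsPlane) :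
    (D.pullback f hf).IsPlane := by
  rintro p ⟨u, v, x, y, h₁, h₂, hne, hp₁, hp₂⟩
  exact hD p ⟨f u, f v, f x, f y, h₁, h₂, fun e => hne (Sym2.map.injective hf e), hp₁, hp₂⟩

theorem pullback_graphSet {V' : Type} (f : V' → V) (hf : Function.Injective f) :
    (D.pullback f hf).graphSet ⊆ D.graphSet := by
  rw [graphSet_eq, graphSet_eq]
  rintro p (⟨x, hx, rfl⟩ | ⟨u, v, h, he, hp⟩)
  · exact Or.inl ⟨f x, mem_univ _, rfl⟩
  · exact Or.inr ⟨f u, f v, h, mem_univ _, hp⟩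

variable {D}

theorem extr_subset_outer [Finite V] {K : Set (ℝ × ℝ)} (hK : IsCompact K)
    (hin : ∀ u v (h : G.Adj u v), D.arcSet h ⊆ (extr K)ᶜ) :
    closure (extr K) ⊆ closure D.outerFace := by
  have hfin : (range D.pos).Finite := finite_range _
  have h1 : extr K ∩ (range D.pos)ᶜ ⊆ D.outerFace := by
    rintro p ⟨hp, hpr⟩
    have hp2 := extr_union_finite hK hfin hp hpr
    have hsub : connectedComponentIn (K ∪ range D.pos)ᶜ p ⊆ D.graphSetᶜ := by
      intro z hz hzg
      have hz1 := extr_comp hp2 hz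
      rw [graphSet_eq] at hzg
      rcases hzg with ⟨x, hx, rfl⟩ | ⟨u, v, h, he, hzp⟩
      · exact hz1.1 (Or.inr ⟨x, rfl⟩)
      · exact hin u v h hzp (extr_anti subset_union_left hz1)
    have hmem := mem_connectedComponentIn (F := (K ∪ range D.pos)ᶜ) hp2.1
    exact ⟨hsub hmem, fun hb => hp2.2 (hb.subset
      (isPreconnected_connectedComponentIn.subset_connectedComponentIn hmem hsub))⟩
  have hd : Dense (range D.pos)ᶜ := hfin.countable.dense_compl ℝ
  have h2 := hd.open_subset_closure_inter (extr_open hK.isClosed)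
  refine closure_minimal (h2.trans (closure_mono h1)) isClosed_closure

end Drawing

open SimpleGraph

theorem sub_colorable (C : Config) (hmin : C.Minimal) {G' : SimpleGraph (Fin C.n)}
    (hle : G' ≤ C.G) (hne : ∃ e ∈ C.G.edgeSet, e ∉ G'.edgeSet)
    (hP : ∀ e ∈ C.P.edges, e ∈ G'.edgeSet) : ListColorable G' C.L := by
  by_contra hnc
  have hsup : (C.P.transfer G' hP).support = C.P.support := Walk.support_transfer _ _
  let C' : Config :=
    { n := C.n
      G := G'
      D := C.D.restrict hle
      plane := C.D.restrict_plane hle C.plane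
      a := C.a
      b := C.b
      P := C.P.transfer G' hP
      P_path := C.P_path.transfer hP
      P_len := by rw [Walk.length_transfer]; exact C.P_len
      P_boundary := by
        intro q hq
        have hq' := hq
        rw [Drawing.walkSet_eq] at hq'
        refine frontier_extr_mono (C.D.restrict_graphSet hle) (C.P_boundary ?_)
          (Drawing.pts_subset_graphSet _ _ _ hq')
        rw [Drawing.walkSet_eq]
        rcases hq' with ⟨x, hx, rfl⟩ | ⟨u, v, h, he, hp⟩
        · exact Or.inl ⟨x, hsup ▸ hx, rfl⟩
        · refine Or.inr ⟨u, v, hle h, ?_, hp⟩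
          rw [Walk.edges_transfer] at he
          exact he
      L := C.L
      size5 := fun v hv => C.size5 v fun h => hv (C.D.restrict_onOuter hle h)
      size3 := fun v _ hvP => by
        by_cases h : C.D.OnOuter v
        · exact C.size3 v h (hsup ▸ hvP)
        · exact le_trans (by norm_num) (C.size5 v h)
      size1 := fun v hv => C.size1 v (hsup ▸ hv)
      no_adjacent_3 := fun u v h => C.no_adjacent_3 u v (hle h)
      proper_on_P := fun u hu v hv h => C.proper_on_P u (hsup ▸ hu) v (hsup ▸ hv) (hle h)
      common_neighbor := fun p₀ p₁ p₂ hp x h₀ h₁ h₂ =>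
        C.common_neighbor p₀ p₁ p₂ (hsup ▸ hp) x (hle h₀) (hle h₁) (hle h₂)
      not_colorable := hnc }
  have h1 := hmin.1 C'
  have h2 : G'.edgeSet.ncard < C.G.edgeSet.ncard := by
    apply Set.ncard_lt_ncard _ (Set.toFinite _)
    obtain ⟨e, he, he'⟩ := hne
    exact ⟨edgeSet_mono hle, fun h => he' (h he)⟩
  have : C.n + C.G.edgeSet.ncard ≤ C.n + G'.edgeSet.ncard := h1
  omega

theorem walk_pullback {V V' : Type} {G : SimpleGraph V} {f : V' → V} {a b : V} (W : G.Walk a b)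
    (hW : ∀ x ∈ W.support, x ∈ range f) : ∀ a', f a' = a →
    ∃ b' : V', ∃ W' : (G.comap f).Walk a' b', W'.support.map f = W.support ∧
      W'.edges.map (Sym2.map f) = W.edges := by
  induction W with
  | nil =>
    rintro a' rfl
    exact ⟨a', Walk.nil, by simp, by simp⟩
  | cons h W ih =>
    rename_i u v w
    rintro a' rfl
    obtain ⟨v', rfl⟩ := hW v (by simp)
    obtain ⟨b', W', h1, h2⟩ := ih (fun x hx => hW x (by simp [hx])) v' rfl
    have h' : (G.comap f).Adj a' v' := h
    exact ⟨b', Walk.cons h' W', by simp [h1], by simp [h2]⟩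

theorem exists_skip {n : ℕ} (y : Fin n) : ∃ m, m + 1 = n ∧ ∃ f : Fin m → Fin n,
    Function.Injective f ∧ (∀ i, f i ≠ y) ∧ ∀ z, z ≠ y → z ∈ range f := by
  obtain _ | m := n
  · exact y.elim0
  · exact ⟨m, rfl, y.succAbove, Fin.succAbove_right_injective, Fin.succAbove_ne y,
      fun z hz => Fin.exists_succAbove_eq hz⟩

theorem no_isolated (C : Config) (hmin : C.Minimal) (y : Fin C.n) (hy : y ∉ C.P.support) :
    ∃ z, C.G.Adj y z := by
  classical
  by_contra! hiso
  obtain ⟨m, hm, f, hf, hfy, hfs⟩ := exists_skip y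
  have hPr : ∀ x ∈ C.P.support, x ∈ range f := fun x hx => hfs x fun h => hy (h ▸ hx)
  obtain ⟨a', ha'⟩ := hPr C.a (by simp)
  obtain ⟨b', P', hP1, hP2⟩ := walk_pullback C.P hPr a' ha'
  have hsup : ∀ x, x ∈ P'.support → f x ∈ C.P.support := fun x hx =>
    hP1 ▸ List.mem_map_of_mem hx
  have hsup' : ∀ x, f x ∈ C.P.support → x ∈ P'.support := fun x hx => by
    rw [← hP1] at hx
    obtain ⟨z, hz, hzx⟩ := List.mem_map.1 hx
    exact hf hzx ▸ hz
  have hout : ∀ v, C.D.OnOuter (f v) → (C.D.pullback f hf).OnOuter v := fun v hv =>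
    frontier_extr_mono (C.D.pullback_graphSet f hf) hv (Or.inl ⟨v, rfl⟩)
  have hLy : (C.L y).Nonempty := by
    rw [← Finset.card_pos]
    by_cases h : C.D.OnOuter y
    · exact lt_of_lt_of_le (by norm_num) (C.size3 y h hy)
    · exact lt_of_lt_of_le (by norm_num) (C.size5 y h)
  obtain ⟨cy, hcy⟩ := hLy
  have hnc : ¬ ListColorable (C.G.comap f) (fun i => C.L (f i)) := by
    rintro ⟨c, hc1, hc2⟩
    apply C.not_colorable
    refine ⟨Function.extend f c fun _ => cy, ?_, ?_⟩
    · intro v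
      by_cases hv : v = y
      · rw [Function.extend_apply' _ _ _ (by rintro ⟨i, hi⟩; exact hfy i (hi.trans hv)), hv]
        exact hcy
      · obtain ⟨i, rfl⟩ := hfs v hv
        rw [hf.extend_apply]
        exact hc1 i
    · intro u v h
      have hu : u ≠ y := fun hh => hiso v (hh ▸ h)
      have hv : v ≠ y := fun hh => hiso u (hh ▸ h.symm)
      obtain ⟨i, rfl⟩ := hfs u hu
      obtain ⟨j, rfl⟩ := hfs v hv
      rw [hf.extend_apply, hf.extend_apply]
      exact hc2 h
  let C' : Config :=
    { n := m
      G := C.G.comap f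
      D := C.D.pullback f hf
      plane := C.D.pullback_plane f hf C.plane
      a := a'
      b := b'
      P := P'
      P_path := by
        rw [Walk.isPath_def]
        exact List.Nodup.of_map f (hP1 ▸ C.P_path.support_nodup)
      P_len := by
        have h1 := congrArg List.length hP2
        rw [List.length_map, Walk.length_edges, Walk.length_edges] at h1
        rw [h1]; exact C.P_len
      P_boundary := by
        intro q hq
        have hq' := hq
        rw [Drawing.walkSet_eq] at hq'
        refine frontier_extr_mono (C.D.pullback_graphSet f hf) (C.P_boundary ?_)
          (Drawing.pts_subset_graphSet _ _ _ hq')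
        rw [Drawing.walkSet_eq]
        rcases hq' with ⟨x, hx, rfl⟩ | ⟨u, v, h, he, hp⟩
        · exact Or.inl ⟨f x, hsup x hx, rfl⟩
        · refine Or.inr ⟨f u, f v, h, ?_, hp⟩
          show s(f u, f v) ∈ C.P.edges
          rw [← hP2]
          exact List.mem_map.2 ⟨_, he, rfl⟩
      L := fun i => C.L (f i)
      size5 := fun v hv => C.size5 _ fun h => hv (hout v h)
      size3 := fun v _ hvP => by
        by_cases h : C.D.OnOuter (f v)
        · exact C.size3 _ h fun hh => hvP (hsup' v hh)
        · exact le_trans (by norm_num) (C.size5 _ h)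
      size1 := fun v hv => C.size1 _ (hsup v hv)
      no_adjacent_3 := fun u v h => C.no_adjacent_3 _ _ h
      proper_on_P := fun u hu v hv h => C.proper_on_P _ (hsup u hu) _ (hsup v hv) h
      common_neighbor := fun p₀ p₁ p₂ hp x h₀ h₁ h₂ =>
        C.common_neighbor (f p₀) (f p₁) (f p₂) (by rw [← hP1, hp]; rfl) (f x) h₀ h₁ h₂
      not_colorable := hnc }
  have h1 : C.n + C.G.edgeSet.ncard ≤ m + (C.G.comap f).edgeSet.ncard := hmin.1 C'
  have h2 : (C.G.comap f).edgeSet.ncard ≤ C.G.edgeSet.ncard := by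
    apply Set.ncard_le_ncard_of_injOn (Sym2.map f)
    · intro e
      induction e with
      | _ u v => exact fun h => h
    · exact (Sym2.map.injective hf).injOn
  omega

/-- The part of the graph drawn in the disc bounded by `K`. -/
def innerG {V : Type} {G : SimpleGraph V} (D : Drawing G) (K : Set (ℝ × ℝ)) : SimpleGraph V where
  Adj z z' := ∃ h : G.Adj z z', D.arcSet h ⊆ (extr K)ᶜ
  symm := ⟨fun _ _ ⟨h, h'⟩ => ⟨h.symm, by rwa [D.arcSet_symm]⟩⟩
  loopless := ⟨fun _ ⟨h, _⟩ => h.ne rfl⟩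

theorem innerG_le {V : Type} {G : SimpleGraph V} (D : Drawing G) (K : Set (ℝ × ℝ)) :
    innerG D K ≤ G := fun _ _ h => h.1

theorem innerG_left {V : Type} {G : SimpleGraph V} {D : Drawing G} {K : Set (ℝ × ℝ)} {u v : V}
    (h : (innerG D K).Adj u v) : D.pos u ∉ extr K := h.2 (D.left_mem h.1)

/-- The vertices of the cycle formed by a path and a further vertex. -/
def cX {V : Type} {G : SimpleGraph V} {a c : V} (b : V) (q : G.Walk a c) : Set V :=
  {x | x ∈ q.support ∨ x = b}

/-- The edges of the cycle formed by a path and a further vertex. -/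
def cE {V : Type} {G : SimpleGraph V} {a c : V} (b : V) (q : G.Walk a c) : Set (Sym2 V) :=
  {e | e ∈ q.edges ∨ e = s(a, b) ∨ e = s(b, c)}

theorem cSat {V : Type} {G : SimpleGraph V} {a c : V} (b : V) (q : G.Walk a c) :
    Drawing.Sat (cX b q) (cE b q) := by
  rintro e (he | rfl | rfl) x hx
  · exact Or.inl (Drawing.walk_sat q _ he _ hx)
  · rcases Sym2.mem_iff.1 hx with rfl | rfl
    · exact Or.inl (by simp)
    · exact Or.inr rfl
  · rcases Sym2.mem_iff.1 hx with rfl | rfl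
    · exact Or.inr rfl
    · exact Or.inl (by simp)

theorem ext_frontier {V : Type} [Finite V] {G : SimpleGraph V} {D : Drawing G} (hD : D.IsPlane)
    {a b c : V} (q : G.Walk a c) (hq : q.IsPath) (hb : b ∉ q.support) (hab : G.Adj a b)
    (hbc : G.Adj b c) (hac : a ≠ c) : D.arcSet hab ⊆ closure (extr (D.pts (cX b q) (cE b q))) := by
  have hW : (q.concat hbc.symm).IsPath := hq.concat hb hbc.symm
  refine (Drawing.arc_frontier hD hab _ hW ?_).trans (closure_mono (extr_anti ?_))
  · rw [Walk.edges_concat]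
    simp only [List.concat_eq_append, List.mem_append, List.mem_singleton]
    rintro (h | h)
    · exact hb (q.snd_mem_support_of_mem_edges h)
    · rcases Sym2.eq_iff.1 h with h | h
      · exact hac h.1
      · exact hab.ne h.1
  · rw [Drawing.walkSet_eq]
    rintro p (⟨x, hx | hx, rfl⟩ | ⟨u, v, h, he | he | he, hp⟩)
    · exact Or.inr (Or.inl ⟨x, by simp [Walk.support_concat, hx], rfl⟩)
    · rw [hx]; exact Or.inl (D.right_mem hab)
    · exact Or.inr (Or.inr ⟨u, v, h, by simp [Walk.edges_concat, he], hp⟩)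
    · left; rwa [D.arcSet_congr hab h he.symm]
    · exact Or.inr (Or.inr ⟨u, v, h, by simp [Walk.edges_concat, he, Sym2.eq_swap], hp⟩)

theorem cX_reverse {V : Type} {G : SimpleGraph V} {a c : V} (b : V) (q : G.Walk a c) :
    cX b q.reverse = cX b q := by ext x; simp [cX]

theorem cE_reverse {V : Type} {G : SimpleGraph V} {a c : V} (b : V) (q : G.Walk a c) :
    cE b q.reverse = cE b q := by
  ext e
  simp only [cE, Walk.edges_reverse, List.mem_reverse, mem_ofPred_eq]
  rw [Sym2.eq_swap (a := c), Sym2.eq_swap (a := b) (b := a)]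
  tauto

theorem ext_color (C : Config) (hmin : C.Minimal) {a b c : Fin C.n} (q : C.G.Walk a c)
    (hq : q.IsPath) (hb : b ∉ q.support) (hab : C.G.Adj a b) (hbc : C.G.Adj b c) (hac : a ≠ c)
    {K : Set (ℝ × ℝ)} (hK : K = C.D.pts (cX b q) (cE b q))
    (hP : ∀ z ∈ C.P.support, C.D.pos z ∉ extr K → z = a ∨ z = b ∨ z = c)
    (hmiss : ∃ e ∈ C.G.edgeSet, e ∉ (innerG C.D K).edgeSet)
    (c0 : Fin C.n → ℕ)
    (hc0 : ∀ z z', (z = a ∨ z = b ∨ z = c) → (z' = a ∨ z' = b ∨ z' = c) → C.G.Adj z z' →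
      c0 z ≠ c0 z')
    (hvi : ∀ x, (innerG C.D K).Adj x a → (innerG C.D K).Adj x b → (innerG C.D K).Adj x c →
      C.L x ≠ {c0 a} ∪ {c0 b} ∪ {c0 c}) :
    ∃ c2 : Fin C.n → ℕ, (∀ z z', (innerG C.D K).Adj z z' → c2 z ≠ c2 z') ∧
      (∀ z, C.D.pos z ∉ extr K → z ≠ a → z ≠ b → z ≠ c → c2 z ∈ C.L z) ∧
      c2 a = c0 a ∧ c2 b = c0 b ∧ c2 c = c0 c := by
  classical
  set D' := C.D.restrict (innerG_le C.D K) with hD'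
  have hKc : IsCompact K := by rw [hK]; exact C.D.pts_compact _ _
  have hab' : (innerG C.D K).Adj a b := ⟨hab, fun p hp hpe => hpe.1 (by
    rw [hK]; exact C.D.arcSet_subset_pts hab (Or.inr (Or.inl rfl)) hp)⟩
  have hbc' : (innerG C.D K).Adj b c := ⟨hbc, fun p hp hpe => hpe.1 (by
    rw [hK]; exact C.D.arcSet_subset_pts hbc (Or.inr (Or.inr rfl)) hp)⟩
  have hT : closure (extr K) ⊆ closure D'.outerFace :=
    Drawing.extr_subset_outer hKc fun u v h => h.2
  have hfr : ∀ p, p ∈ D'.arcSet hab' ∨ p ∈ D'.arcSet hbc' → p ∈ frontier D'.outerFace := by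
    intro p hp
    apply mem_frontier_of
    · apply hT
      rw [hK]
      rcases hp with hp | hp
      · exact ext_frontier C.plane q hq hb hab hbc hac hp
      · have := ext_frontier C.plane q.reverse hq.reverse (by simpa using hb) hbc.symm hab.symm
          hac.symm
        rw [cX_reverse, cE_reverse, C.D.arcSet_symm hbc] at this
        exact this hp
    · intro h
      apply h.1
      rw [Drawing.graphSet_eq]
      rcases hp with hp | hp
      · exact Or.inr ⟨a, b, hab', mem_univ _, hp⟩
      · exact Or.inr ⟨b, c, hbc', mem_univ _, hp⟩
  let L' : Fin C.n → Finset ℕ := fun z => if z = a ∨ z = b ∨ z = c then {c0 z} else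
    if C.D.pos z ∉ extr K then C.L z else Finset.range 5
  have hL1 : ∀ z, (z = a ∨ z = b ∨ z = c) → L' z = {c0 z} := fun z hz => if_pos hz
  have hL2 : ∀ z, ¬ (z = a ∨ z = b ∨ z = c) → C.D.pos z ∉ extr K → L' z = C.L z :=
    fun z hz hzK => by simp only [L']; rw [if_neg hz, if_pos hzK]
  have hL3 : ∀ z, ¬ (z = a ∨ z = b ∨ z = c) → ¬ C.D.pos z ∉ extr K → (L' z).card = 5 :=
    fun z hz hzK => by simp only [L']; rw [if_neg hz, if_neg hzK]; simp
  have houtabc : ∀ z, (z = a ∨ z = b ∨ z = c) → D'.OnOuter z := by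
    rintro z (rfl | rfl | rfl)
    · exact hfr _ (Or.inl (D'.left_mem hab'))
    · exact hfr _ (Or.inl (D'.right_mem hab'))
    · exact hfr _ (Or.inr (D'.right_mem hbc'))
  let P' : (innerG C.D K).Walk a c := Walk.cons hab' (Walk.cons hbc' Walk.nil)
  have hsup : ∀ z, z ∈ P'.support ↔ (z = a ∨ z = b ∨ z = c) := by
    intro z; simp [P']
  have hcol : ListColorable (innerG C.D K) L' := by
    by_contra hnc
    let C' : Config :=
      { n := C.n
        G := innerG C.D K
        D := D'
        plane := C.D.restrict_plane _ C.plane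
        a := a
        b := c
        P := P'
        P_path := by
          rw [Walk.isPath_def]
          simp [P', hab.ne, hbc.ne, hac]
        P_len := by simp [P']
        P_boundary := by
          intro p hp
          simp only [P', Drawing.walkSet_cons] at hp
          rcases hp with hp | hp | hp
          · exact hfr p (Or.inl hp)
          · exact hfr p (Or.inr hp)
          · have : p = D'.pos c := by
              simpa [Drawing.walkSet, eq_comm] using hp
            rw [this]; exact hfr _ (Or.inr (D'.right_mem hbc'))
        L := L'
        size5 := by
          intro z hz
          have hz1 : ¬ (z = a ∨ z = b ∨ z = c) := fun h => hz (houtabc z h)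
          by_cases hzK : C.D.pos z ∉ extr K
          · rw [hL2 z hz1 hzK]
            exact C.size5 z fun h => hz (C.D.restrict_onOuter _ h)
          · exact (hL3 z hz1 hzK).ge
        size3 := by
          intro z _ hzP
          rw [hsup] at hzP
          by_cases hzK : C.D.pos z ∉ extr K
          · rw [hL2 z hzP hzK]
            by_cases h : C.D.OnOuter z
            · exact C.size3 z h fun h' => hzP (hP z h' hzK)
            · exact le_trans (by norm_num) (C.size5 z h)
          · rw [hL3 z hzP hzK]; norm_num
        size1 := fun z hz => by
          rw [hsup] at hz
          rw [hL1 z hz, Finset.card_singleton]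
        no_adjacent_3 := by
          intro z z' h h3 h3'
          have key : ∀ z z', (innerG C.D K).Adj z z' → (L' z).card = 3 → L' z = C.L z := by
            intro z z' h h3
            by_cases hz : z = a ∨ z = b ∨ z = c
            · rw [hL1 z hz, Finset.card_singleton] at h3; omega
            · exact hL2 z hz (innerG_left h)
          rw [key z z' h h3] at h3
          rw [key z' z h.symm h3'] at h3'
          exact C.no_adjacent_3 z z' h.1 h3 h3'
        proper_on_P := by
          intro z hz z' hz' h
          rw [hsup] at hz hz'
          rw [hL1 z hz, hL1 z' hz']
          exact fun e => hc0 z z' hz hz' h.1 (Finset.singleton_injective e)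
        common_neighbor := by
          intro p₀ p₁ p₂ hp x h₀ h₁ h₂
          have : [a, b, c] = [p₀, p₁, p₂] := by simpa [P'] using hp
          simp only [List.cons.injEq, and_true] at this
          obtain ⟨rfl, rfl, rfl⟩ := this
          have hx : ¬ (x = a ∨ x = b ∨ x = c) := by
            rintro (h | h | h)
            · exact h₀.ne h
            · exact h₁.ne h
            · exact h₂.ne h
          rw [hL2 x hx (innerG_left h₀), hL1 a (by simp), hL1 b (by simp), hL1 c (by simp)]
          exact hvi x h₀ h₁ h₂
        not_colorable := hnc }
    have h1 : C.n + C.G.edgeSet.ncard ≤ C.n + (innerG C.D K).edgeSet.ncard := hmin.1 C'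
    have h2 : (innerG C.D K).edgeSet.ncard < C.G.edgeSet.ncard := by
      apply Set.ncard_lt_ncard _ (Set.toFinite _)
      obtain ⟨e, he, he'⟩ := hmiss
      exact ⟨edgeSet_mono (innerG_le _ _), fun h => he' (h he)⟩
    omega
  obtain ⟨c2, h1, h2⟩ := hcol
  have h3 : ∀ z, (z = a ∨ z = b ∨ z = c) → c2 z = c0 z := fun z hz => by
    have := h1 z
    rw [hL1 z hz] at this
    exact Finset.mem_singleton.1 this
  refine ⟨c2, fun z z' h => h2 h, fun z hz ha hb hc => ?_, h3 a (by simp), h3 b (by simp),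
    h3 c (by simp)⟩
  have := h1 z
  rwa [hL2 z (by tauto) hz] at this

theorem path_split {V : Type} {G : SimpleGraph V} {u w x : V} (p : G.Walk u w) (hp : p.IsPath)
    (hx : x ∈ p.support) : ∃ (qa : G.Walk u x) (qb : G.Walk x w), qa.IsPath ∧ qb.IsPath ∧
      (∀ z, z ∈ p.support ↔ z ∈ qa.support ∨ z ∈ qb.support) ∧
      (∀ e, e ∈ p.edges ↔ e ∈ qa.edges ∨ e ∈ qb.edges) ∧
      (∀ z, z ∈ qa.support → z ∈ qb.support → z = x) := by
  classical
  refine ⟨p.takeUntil x hx, p.dropUntil x hx, hp.takeUntil hx, hp.dropUntil hx, ?_, ?_, ?_⟩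
  · intro z
    rw [← Walk.mem_support_append_iff, Walk.take_spec]
  · intro e
    rw [← List.mem_append, ← Walk.edges_append, Walk.take_spec]
  · intro z h1 h2
    have hn : ((p.takeUntil x hx).append (p.dropUntil x hx)).support.Nodup := by
      rw [Walk.take_spec]; exact hp.support_nodup
    rw [Walk.support_append] at hn
    have hd := List.disjoint_of_nodup_append hn
    rw [← Walk.cons_tail_support, List.mem_cons] at h2
    rcases h2 with h2 | h2
    · exact h2
    · exact absurd h2 (hd h1)

theorem cycle_path_aux {V : Type} {G : SimpleGraph V} {u v w : V} (C : G.Walk u u)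
    (hC : C.IsCycle) (hs : C.snd = v) (h2 : s(v, w) ∈ C.edges) (huw : u ≠ w) :
    ∃ p : G.Walk u w, p.IsPath ∧ v ∉ p.support ∧
      (∀ e, e ∈ C.edges ↔ e ∈ p.edges ∨ e = s(u, v) ∨ e = s(v, w)) ∧
      (∀ x, x ∈ C.support ↔ x ∈ p.support ∨ x = v) := by
  cases C with
  | nil => exact absurd hC Walk.not_isCycle_nil
  | cons h1 rest =>
    rename_i v1
    rw [Walk.snd_cons] at hs
    subst hs
    rw [Walk.cons_isCycle_iff] at hC
    cases rest with
    | nil => exact absurd rfl h1.ne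
    | cons h3 rest2 =>
      rename_i v2
      have hp := (Walk.cons_isPath_iff _ _).1 hC.1
      have hv2 : w = v2 := by
        simp only [Walk.edges_cons, List.mem_cons] at h2
        rcases h2 with h2 | h2 | h2
        · rcases Sym2.eq_iff.1 h2 with h | h
          · exact absurd h.1 h1.ne.symm
          · exact absurd h.2.symm huw
        · rcases Sym2.eq_iff.1 h2 with h | h
          · exact h.2
          · exact absurd h.1 h3.ne
        · exact absurd (Walk.fst_mem_support_of_mem_edges _ h2) hp.2
      subst hv2
      refine ⟨rest2.reverse, hp.1.reverse, by simpa using hp.2, ?_, ?_⟩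
      · intro e
        simp only [Walk.edges_cons, List.mem_cons, Walk.edges_reverse, List.mem_reverse]
        tauto
      · intro x
        simp only [Walk.support_cons, List.mem_cons, Walk.support_reverse, List.mem_reverse]
        constructor
        · rintro (rfl | h | h)
          · exact Or.inl (Walk.end_mem_support _)
          · exact Or.inr h
          · exact Or.inl h
        · tauto

theorem cycle_path {V : Type} {G : SimpleGraph V} {u v w : V} (C : G.Walk u u)
    (hC : C.IsCycle) (h1 : s(u, v) ∈ C.edges) (h2 : s(v, w) ∈ C.edges) (huw : u ≠ w) :
    ∃ p : G.Walk u w, p.IsPath ∧ v ∉ p.support ∧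
      (∀ e, e ∈ C.edges ↔ e ∈ p.edges ∨ e = s(u, v) ∨ e = s(v, w)) ∧
      (∀ x, x ∈ C.support ↔ x ∈ p.support ∨ x = v) := by
  have h3 : v ∈ C.toSubgraph.neighborSet u := Walk.adj_toSubgraph_iff_mem_edges.2 h1
  rw [hC.neighborSet_toSubgraph_endpoint] at h3
  rcases h3 with h3 | h3
  · exact cycle_path_aux C hC h3.symm h2 huw
  · have h3' : v = C.penultimate := h3
    obtain ⟨p, hp1, hp2, hp3, hp4⟩ := cycle_path_aux (v := v) C.reverse hC.reverse
      (by rw [Walk.snd_reverse]; exact h3'.symm) (by simpa using h2) huw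
    refine ⟨p, hp1, hp2, fun e => ?_, fun x => ?_⟩
    · rw [← hp3]; simp
    · rw [← hp4]; simp

theorem cycle_edge {V : Type} {G : SimpleGraph V} {r x : V} (C : G.Walk r r) (hC : C.IsCycle)
    (hx : x ∈ C.support) : ∃ t, s(x, t) ∈ C.edges := by
  have h := hC.ncard_neighborSet_toSubgraph_eq_two hx
  have hne : (C.toSubgraph.neighborSet x).Nonempty := by
    rw [nonempty_iff_ne_empty]
    intro h'
    rw [h', Set.ncard_empty] at h
    omega
  obtain ⟨t, ht⟩ := hne
  exact ⟨t, Walk.adj_toSubgraph_iff_mem_edges.1 ht⟩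

theorem cycle_nbr_eq {V : Type} [Finite V] {G : SimpleGraph V} {r r' x : V} (C : G.Walk r r)
    (C' : G.Walk r' r') (hC : C.IsCycle) (hC' : C'.IsCycle) (hx : x ∈ C.support)
    (hsub : ∀ t, s(x, t) ∈ C.edges → s(x, t) ∈ C'.edges) (t : V) (ht : s(x, t) ∈ C'.edges) :
    s(x, t) ∈ C.edges := by
  obtain ⟨t0, ht0⟩ := cycle_edge C hC hx
  have hx' : x ∈ C'.support := Walk.fst_mem_support_of_mem_edges _ (hsub _ ht0)
  have heq : C.toSubgraph.neighborSet x = C'.toSubgraph.neighborSet x := by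
    apply Set.eq_of_subset_of_ncard_le _ _ (Set.toFinite _)
    · intro z hz
      exact Walk.adj_toSubgraph_iff_mem_edges.2 (hsub z (Walk.adj_toSubgraph_iff_mem_edges.1 hz))
    · rw [hC.ncard_neighborSet_toSubgraph_eq_two hx, hC'.ncard_neighborSet_toSubgraph_eq_two hx']
  have h : t ∈ C'.toSubgraph.neighborSet x := Walk.adj_toSubgraph_iff_mem_edges.2 ht
  rw [← heq] at h
  exact Walk.adj_toSubgraph_iff_mem_edges.1 h

theorem glue_aux {V : Type} [Finite V] {G : SimpleGraph V} {D : Drawing G} (hD : D.IsPlane)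
    {X₁ X₂ S : Set V} {E₁ E₂ : Set (Sym2 V)} (hs₂ : Drawing.Sat X₂ E₂)
    (hs₁ : Drawing.Sat X₁ E₁)
    (hS : ∀ z ∈ X₂, z ∉ S → D.OnOuter z ∧ z ∉ X₁) {z z' : V}
    (h : (innerG D (D.pts X₁ E₁)).Adj z z') (h' : ¬ (innerG D (D.pts X₂ E₂)).Adj z z') :
    D.pos z ∈ extr (D.pts X₂ E₂) ∨ z ∈ S := by
  by_contra! hcon
  by_cases hz : z ∈ X₂
  · obtain ⟨h1, h2⟩ := hS z hz hcon.2
    exact innerG_left h (Drawing.outer_not_in h1 fun h3 => h2 (Drawing.pos_mem_pts hs₁ h3))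
  · exact h' ⟨h.1, Drawing.edge_in_of_vertex hD h.1
      (fun h3 => hz (Drawing.pos_mem_pts hs₂ h3)) hcon.1⟩

open Classical in
theorem glue_color {V : Type} [Finite V] {G : SimpleGraph V} {D : Drawing G} (hD : D.IsPlane)
    {X₁ X₂ S : Set V} {E₁ E₂ : Set (Sym2 V)} (hs₂ : Drawing.Sat X₂ E₂)
    (hs₁ : Drawing.Sat X₁ E₁)
    (hS : ∀ z ∈ X₂, z ∉ S → D.OnOuter z ∧ z ∉ X₁) (c1 c2 : V → ℕ)
    (hagree : ∀ z ∈ S, c1 z = c2 z)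
    (h1 : ∀ z z', (innerG D (D.pts X₁ E₁)).Adj z z' →
      (D.pos z ∈ extr (D.pts X₂ E₂) ∨ z ∈ S) → (D.pos z' ∈ extr (D.pts X₂ E₂) ∨ z' ∈ S) →
      c1 z ≠ c1 z')
    (h2 : ∀ z z', (innerG D (D.pts X₂ E₂)).Adj z z' → c2 z ≠ c2 z') {z z' : V}
    (h : (innerG D (D.pts X₁ E₁)).Adj z z' ∨ (innerG D (D.pts X₂ E₂)).Adj z z') :
    (if D.pos z ∉ extr (D.pts X₂ E₂) then c2 z else c1 z) ≠
      (if D.pos z' ∉ extr (D.pts X₂ E₂) then c2 z' else c1 z') := by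
  by_cases h' : (innerG D (D.pts X₂ E₂)).Adj z z'
  · rw [if_pos (innerG_left h'), if_pos (innerG_left h'.symm)]
    exact h2 z z' h'
  · have h := h.resolve_right h'
    have key : ∀ y, (D.pos y ∈ extr (D.pts X₂ E₂) ∨ y ∈ S) →
        (if D.pos y ∉ extr (D.pts X₂ E₂) then c2 y else c1 y) = c1 y := by
      intro y hy
      by_cases hif : D.pos y ∉ extr (D.pts X₂ E₂)
      · rw [if_pos hif]
        exact (hagree y (hy.resolve_left hif)).symm
      · rw [if_neg hif]
    have a1 := glue_aux hD hs₂ hs₁ hS h h'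
    have a2 := glue_aux hD hs₂ hs₁ hS h.symm fun hh => h' hh.symm
    rw [key z a1, key z' a2]
    exact h1 z z' h a1 a2

theorem sub_color (C : Config) (hmin : C.Minimal) (B : Set (Fin C.n))
    (hB : ∀ z ∈ C.P.support, z ∉ B) (y : Fin C.n) (hy : y ∈ B) :
    ∃ c1 : Fin C.n → ℕ, (∀ z, c1 z ∈ C.L z) ∧
      ∀ z z', C.G.Adj z z' → z ∉ B → z' ∉ B → c1 z ≠ c1 z' := by
  let G' : SimpleGraph (Fin C.n) :=
    { Adj := fun z z' => C.G.Adj z z' ∧ z ∉ B ∧ z' ∉ B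
      symm := ⟨fun _ _ h => ⟨h.1.symm, h.2.2, h.2.1⟩⟩
      loopless := ⟨fun _ h => h.1.ne rfl⟩ }
  obtain ⟨t, ht⟩ := no_isolated C hmin y fun h => hB y h hy
  obtain ⟨c, hc1, hc2⟩ := sub_colorable C hmin (G' := G') (fun _ _ h => h.1)
    ⟨s(y, t), ht, fun h => h.2.1 hy⟩ (by
      intro e
      induction e with
      | _ z z' =>
        intro he
        exact ⟨Walk.adj_of_mem_edges _ he, hB z (Walk.fst_mem_support_of_mem_edges _ he),
          hB z' (Walk.snd_mem_support_of_mem_edges _ he)⟩)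
  exact ⟨c, hc1, fun z z' h h1 h2 => hc2 ⟨h, h1, h2⟩⟩

theorem outer_edge_not_inner {V : Type} [Finite V] {G : SimpleGraph V} {D : Drawing G}
    (hD : D.IsPlane) {r : V} {F : G.Walk r r} (hF : D.BoundsOuter F) {X : Set V}
    {E : Set (Sym2 V)} {e : Sym2 V} (he : e ∈ F.edges) (heE : e ∉ E) :
    e ∉ (innerG D (D.pts X E)).edgeSet := by
  induction e with
  | _ a b =>
    rintro ⟨h, hin⟩
    obtain ⟨m, hm⟩ := D.interior_nonempty h
    refine hin (D.arcInterior_subset h hm) (Drawing.outer_not_in ?_ fun h' =>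
      heE (Drawing.interior_mem_pts hD hm h'))
    rw [hF, Drawing.walkSet_eq]
    exact D.arcSet_subset_pts h he (D.arcInterior_subset h hm)

theorem arcSet_preconnected {V : Type} {G : SimpleGraph V} (D : Drawing G) {u v : V}
    (h : G.Adj u v) : IsPreconnected (D.arcSet h) :=
  isPreconnected_range (D.arc h).continuous

theorem preconnected_one {V : Type} {G : SimpleGraph V} (D : Drawing G) {u v : V}
    (h : G.Adj u v) {X : Set V} {E : Set (Sym2 V)} (hX : ∀ z ∈ X, z = u ∨ z = v)
    (hs : Drawing.Sat X E) (hE : s(u, v) ∈ E) : IsPreconnected (D.pts X E) := by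
  have : D.pts X E = D.arcSet h := by
    apply Subset.antisymm _ (D.arcSet_subset_pts h hE)
    rintro p (⟨x, hx, rfl⟩ | ⟨a, b, h', he, hp⟩)
    · rcases hX x hx with rfl | rfl
      · exact D.left_mem h
      · exact D.right_mem h
    · have ha := hX a (hs _ he _ (Sym2.mem_mk_left _ _))
      have hb := hX b (hs _ he _ (Sym2.mem_mk_right _ _))
      have hne := h'.ne
      rw [D.arcSet_congr h h']
      · exact hp
      · rcases ha with rfl | rfl <;> rcases hb with rfl | rfl
        · exact absurd rfl hne
        · rfl
        · exact Sym2.eq_swap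
        · exact absurd rfl hne
  rw [this]
  exact arcSet_preconnected D h

theorem preconnected_two {V : Type} {G : SimpleGraph V} (D : Drawing G) {u v w : V}
    (h : G.Adj u v) (h₂ : G.Adj v w) {X : Set V} {E : Set (Sym2 V)}
    (hX : ∀ z ∈ X, z = u ∨ z = v ∨ z = w)
    (hE : ∀ e, e ∈ E ↔ e = s(u, v) ∨ e = s(v, w)) : IsPreconnected (D.pts X E) := by
  have : D.pts X E = D.arcSet h ∪ D.arcSet h₂ := by
    apply Subset.antisymm _ (union_subset (D.arcSet_subset_pts h ((hE _).2 (Or.inl rfl)))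
      (D.arcSet_subset_pts h₂ ((hE _).2 (Or.inr rfl))))
    rintro p (⟨x, hx, rfl⟩ | ⟨a, b, h', he, hp⟩)
    · rcases hX x hx with rfl | rfl | rfl
      · exact Or.inl (D.left_mem h)
      · exact Or.inl (D.right_mem h)
      · exact Or.inr (D.right_mem h₂)
    · rcases (hE _).1 he with he | he
      · left; rwa [D.arcSet_congr h h' he.symm]
      · right; rwa [D.arcSet_congr h₂ h' he.symm]
  rw [this]
  exact (arcSet_preconnected D h).union (D.pos v) (D.right_mem h) (D.left_mem h₂)
    (arcSet_preconnected D h₂)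

set_option maxHeartbeats 4000000


/-- In a minimal counterexample configuration for the precolored-path 5-choosability
theorem, let `u v w` be a 2-chord of the cycle `F` bounding the outer face, and let
`C₁, C₂` be the two cycles in `F ∪ uvw` containing the 2-chord, where the closed disc
bounded by `C₁` contains the precolored path (the `uvw`-components of `G` are the
subgraphs drawn in the closed discs bounded by `C₁` and `C₂`).  Then either `u` and `w`
are adjacent and the second component is the triangle `uvw`, or the second component
consists of `u, v, w` and one further vertex `x` with a list of size three adjacent to
all of `u`, `v` and `w`. -/
theorem minimal_counterexample_2chords
    (C : Config) (hmin : C.Minimal)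
    {r : Fin C.n} (F : C.G.Walk r r) (hFcyc : F.IsCycle) (hFbd : C.D.BoundsOuter F)
    (u v w : Fin C.n) (huv : C.G.Adj u v) (hvw : C.G.Adj v w) (huw : u ≠ w)
    (hu : u ∈ F.support) (hw : w ∈ F.support) (hv : v ∉ F.support)
    (C₁ : C.G.Walk u u) (C₂ : C.G.Walk u u)
    (hC₁ : C₁.IsCycle) (hC₂ : C₂.IsCycle)
    (hQ₁ : s(u, v) ∈ C₁.edges ∧ s(v, w) ∈ C₁.edges)
    (hQ₂ : s(u, v) ∈ C₂.edges ∧ s(v, w) ∈ C₂.edges)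
    (hunion : ∀ e : Sym2 (Fin C.n),
      (e ∈ C₁.edges ∨ e ∈ C₂.edges) ↔ (e ∈ F.edges ∨ e = s(u, v) ∨ e = s(v, w)))
    (hinter : ∀ e : Sym2 (Fin C.n), e ∈ C₁.edges → e ∈ C₂.edges →
      e = s(u, v) ∨ e = s(v, w))
    (hPside : ∀ p ∈ C.P.support, C.D.pos p ∈ C.D.closedDisc C₁) :
    (C.G.Adj u w ∧
      ∀ z : Fin C.n, C.D.pos z ∈ C.D.closedDisc C₂ → z = u ∨ z = v ∨ z = w) ∨
    (∃ x : Fin C.n, C.G.Adj x u ∧ C.G.Adj x v ∧ C.G.Adj x w ∧ (C.L x).card = 3 ∧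
      ∀ z : Fin C.n, C.D.pos z ∈ C.D.closedDisc C₂ →
        z = u ∨ z = v ∨ z = w ∨ z = x) := by
  classical
  obtain ⟨p₁, hp₁, hvp₁, he₁, hsup₁⟩ := cycle_path C₁ hC₁ hQ₁.1 hQ₁.2 huw
  obtain ⟨p₂, hp₂, hvp₂, he₂, hsup₂⟩ := cycle_path C₂ hC₂ hQ₂.1 hQ₂.2 huw
  have hX₁ : ∀ z, z ∈ cX v p₁ ↔ z ∈ C₁.support := fun z => (hsup₁ z).symm
  have hX₂ : ∀ z, z ∈ cX v p₂ ↔ z ∈ C₂.support := fun z => (hsup₂ z).symm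
  have hE₁ : ∀ e, e ∈ cE v p₁ ↔ e ∈ C₁.edges := fun e => (he₁ e).symm
  have hE₂ : ∀ e, e ∈ cE v p₂ ↔ e ∈ C₂.edges := fun e => (he₂ e).symm
  have hK₁ : C.D.walkSet C₁ = C.D.pts (cX v p₁) (cE v p₁) := by
    rw [Drawing.walkSet_eq]
    congr 1
    · ext z; exact (hX₁ z).symm
    · ext e; exact (hE₁ e).symm
  have hK₂ : C.D.walkSet C₂ = C.D.pts (cX v p₂) (cE v p₂) := by
    rw [Drawing.walkSet_eq]
    congr 1
    · ext z; exact (hX₂ z).symm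
    · ext e; exact (hE₂ e).symm
  have hdisc : ∀ (W : C.G.Walk u u) (p : ℝ × ℝ),
      p ∈ C.D.closedDisc W ↔ p ∉ extr (C.D.walkSet W) := by
    intro W p
    constructor
    · rintro (h | h) h'
      · exact h'.1 h
      · exact h'.2 h.2
    · intro h
      by_cases hp : p ∈ C.D.walkSet W
      · exact Or.inl hp
      · refine Or.inr ⟨hp, ?_⟩
        by_contra hb
        exact h ⟨hp, hb⟩
  set K₁ := C.D.pts (cX v p₁) (cE v p₁) with hK₁def
  set K₂ := C.D.pts (cX v p₂) (cE v p₂) with hK₂def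
  simp only [hdisc, hK₁, hK₂] at hPside ⊢
  -- vertices and edges on the outer face
  have hFout : ∀ z, z ∈ F.support → C.D.OnOuter z := by
    intro z hz
    show C.D.pos z ∈ frontier C.D.outerFace
    rw [hFbd]
    exact Or.inl ⟨z, hz, rfl⟩
  have hedge : ∀ z t, z ≠ u → z ≠ v → z ≠ w →
      (s(z, t) ∈ C₁.edges ∨ s(z, t) ∈ C₂.edges) → s(z, t) ∈ F.edges := by
    intro z t h1 h2 h3 h
    rcases (hunion _).1 h with h | h | h
    · exact h
    · rcases Sym2.eq_iff.1 h with h | h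
      · exact absurd h.1 h1
      · exact absurd h.1 h2
    · rcases Sym2.eq_iff.1 h with h | h
      · exact absurd h.1 h2
      · exact absurd h.1 h3
  have hp₂F : ∀ z, z ∈ p₂.support → z ∈ F.support := by
    intro z hz
    by_cases h1 : z = u
    · rw [h1]; exact hu
    by_cases h3 : z = w
    · rw [h3]; exact hw
    have h2 : z ≠ v := fun h => hvp₂ (h ▸ hz)
    obtain ⟨t, ht⟩ := cycle_edge C₂ hC₂ ((hX₂ z).1 (Or.inl hz))
    exact Walk.fst_mem_support_of_mem_edges _ (hedge z t h1 h2 h3 (Or.inr ht))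
  have hXX : ∀ z, z ∈ cX v p₁ → z ∈ cX v p₂ → z = u ∨ z = v ∨ z = w := by
    intro z hz1 hz2
    by_contra! hcon
    obtain ⟨h1, h2, h3⟩ := hcon
    rw [hX₁] at hz1
    rw [hX₂] at hz2
    obtain ⟨t, ht⟩ := cycle_edge C₁ hC₁ hz1
    have ht2 := cycle_nbr_eq C₂ F hC₂ hFcyc hz2 (fun t ht => hedge z t h1 h2 h3 (Or.inr ht)) t
      (hedge z t h1 h2 h3 (Or.inl ht))
    rcases hinter _ ht ht2 with h | h
    · rcases Sym2.eq_iff.1 h with h | h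
      · exact h1 h.1
      · exact h2 h.1
    · rcases Sym2.eq_iff.1 h with h | h
      · exact h2 h.1
      · exact h3 h.1
  have hFK : C.D.walkSet F ⊆ K₁ ∪ K₂ := by
    rw [Drawing.walkSet_eq]
    have key : ∀ a b (h : C.G.Adj a b), s(a, b) ∈ F.edges → C.D.arcSet h ⊆ K₁ ∪ K₂ := by
      intro a b h he
      rcases (hunion _).2 (Or.inl he) with h' | h'
      · exact (C.D.arcSet_subset_pts h ((hE₁ _).2 h')).trans subset_union_left
      · exact (C.D.arcSet_subset_pts h ((hE₂ _).2 h')).trans subset_union_right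
    rintro p (⟨z, hz, rfl⟩ | ⟨a, b, h, he, hp⟩)
    · obtain ⟨t, ht⟩ := cycle_edge F hFcyc hz
      have hadj : C.G.Adj z t := Walk.adj_of_mem_edges _ ht
      exact key z t hadj ht (C.D.left_mem hadj)
    · exact key a b h he hp
  have hconn : IsPreconnected (K₁ ∩ K₂) := by
    rw [hK₁def, hK₂def, Drawing.pts_inter C.plane (cSat _ _) (cSat _ _)]
    apply preconnected_two C.D huv hvw
    · rintro z ⟨h1, h2⟩
      exact hXX z h1 h2
    · intro e
      constructor
      · rintro ⟨h1, h2⟩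
        exact hinter e ((hE₁ e).1 h1) ((hE₂ e).1 h2)
      · rintro (rfl | rfl)
        · exact ⟨Or.inr (Or.inl rfl), Or.inr (Or.inl rfl)⟩
        · exact ⟨Or.inr (Or.inr rfl), Or.inr (Or.inr rfl)⟩
  have hsplit : ∀ z z', C.G.Adj z z' →
      (innerG C.D K₁).Adj z z' ∨ (innerG C.D K₂).Adj z z' := by
    intro z z' h
    rcases Drawing.edge_split C.plane hFK hconn h (fun p hp => Drawing.graph_in_F hFbd (by
      rw [Drawing.graphSet_eq]; exact Or.inr ⟨z, z', h, mem_univ _, hp⟩)) with h' | h'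
    · exact Or.inl ⟨h, h'⟩
    · exact Or.inr ⟨h, h'⟩
  have hPout : ∀ z ∈ C.P.support, C.D.OnOuter z := fun z hz =>
    C.P_boundary (Or.inl ⟨z, hz, rfl⟩)
  have hPA : ∀ z ∈ C.P.support, C.D.pos z ∉ extr K₂ → z = u ∨ z = v ∨ z = w := by
    intro z hz hzA
    apply hXX
    · by_contra h
      exact hPside z hz (Drawing.outer_not_in (hPout z hz) fun h' =>
        h (Drawing.pos_mem_pts (cSat _ _) h'))
    · by_contra h
      exact hzA (Drawing.outer_not_in (hPout z hz) fun h' =>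
        h (Drawing.pos_mem_pts (cSat _ _) h'))
  -- an edge of the first cycle outside the second disc
  obtain ⟨e₀, he₀F, he₀2, he₀v⟩ : ∃ e, e ∈ F.edges ∧ e ∉ p₂.edges ∧ v ∉ e := by
    cases hp : p₁ with
    | nil => exact absurd rfl huw
    | cons h rest =>
      rename_i t
      have hmem : s(u, t) ∈ p₁.edges := by rw [hp]; simp
      have hv' : v ∉ s(u, t) := fun hh =>
        hvp₁ (Drawing.walk_sat p₁ _ hmem _ hh)
      have hne : ∀ e, (e = s(u, v) ∨ e = s(v, w)) → v ∈ e := by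
        rintro e (rfl | rfl) <;> simp
      have hm1 := (he₁ _).2 (Or.inl hmem)
      refine ⟨s(u, t), ?_, ?_, hv'⟩
      · rcases (hunion _).1 (Or.inl hm1) with h' | h'
        · exact h'
        · exact absurd (hne _ h') hv'
      · intro h'
        exact hv' (hne _ (hinter _ hm1 ((he₂ _).2 (Or.inl h'))))
  have hmiss : ∀ {a c : Fin C.n} (q : C.G.Walk a c), (∀ e ∈ q.edges, e ∈ p₂.edges) →
      ∃ e ∈ C.G.edgeSet, e ∉ (innerG C.D (C.D.pts (cX v q) (cE v q))).edgeSet := by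
    intro a c q hq
    refine ⟨e₀, Walk.edges_subset_edgeSet _ he₀F, outer_edge_not_inner C.plane hFbd he₀F ?_⟩
    rintro (h | h | h)
    · exact he₀2 (hq _ h)
    · exact he₀v (by rw [h]; simp)
    · exact he₀v (by rw [h]; simp)
  -- combining colourings
  have hfinal : ∀ c1 c2 : Fin C.n → ℕ, (∀ z, c1 z ∈ C.L z) →
      (∀ z z', C.G.Adj z z' → (C.D.pos z ∈ extr K₂ ∨ z = u ∨ z = v ∨ z = w) →
        (C.D.pos z' ∈ extr K₂ ∨ z' = u ∨ z' = v ∨ z' = w) → c1 z ≠ c1 z') →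
      (∀ z z', (innerG C.D K₂).Adj z z' → c2 z ≠ c2 z') →
      (∀ z, C.D.pos z ∉ extr K₂ → z ≠ u → z ≠ v → z ≠ w → c2 z ∈ C.L z) →
      c2 u = c1 u → c2 v = c1 v → c2 w = c1 w → False := by
    intro c1 c2 hL1 hpr1 hpr2 hL2 hcu hcv hcw
    apply C.not_colorable
    refine ⟨fun z => if C.D.pos z ∉ extr K₂ then c2 z else c1 z, ?_, ?_⟩
    · intro z
      show (if C.D.pos z ∉ extr K₂ then c2 z else c1 z) ∈ C.L z
      by_cases hz : C.D.pos z ∉ extr K₂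
      · rw [if_pos hz]
        by_cases h1 : z = u
        · rw [h1, hcu]; exact hL1 _
        by_cases h2 : z = v
        · rw [h2, hcv]; exact hL1 _
        by_cases h3 : z = w
        · rw [h3, hcw]; exact hL1 _
        exact hL2 z hz h1 h2 h3
      · rw [if_neg hz]; exact hL1 z
    · intro z z' h
      refine glue_color (S := {z | z = u ∨ z = v ∨ z = w}) C.plane (cSat v p₂) (cSat v p₁) ?_
        c1 c2 ?_ (fun z z' h a b => hpr1 z z' h.1 a b) hpr2 (hsplit z z' h)
      · intro z hz hzS
        refine ⟨?_, fun h1 => hzS (hXX z h1 hz)⟩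
        rcases hz with hz | hz
        · exact hFout z (hp₂F z hz)
        · exact absurd (Or.inr (Or.inl hz)) hzS
      · rintro z (rfl | rfl | rfl)
        · exact hcu.symm
        · exact hcv.symm
        · exact hcw.symm
  have hX2A : ∀ z, z ∈ cX v p₂ → C.D.pos z ∉ extr K₂ := fun z hz h => h.1 (Or.inl ⟨z, hz, rfl⟩)
  have hin3 : ∀ z, C.D.pos z ∉ extr K₂ → ¬ (z = u ∨ z = v ∨ z = w) → 3 ≤ (C.L z).card := by
    intro z hz hz'
    by_cases h : C.D.OnOuter z
    · exact C.size3 z h fun h' => hz' (hPA z h' hz)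
    · exact le_trans (by norm_num) (C.size5 z h)
  have hcard3 : ∀ a b c : ℕ, (({a} ∪ {b} ∪ {c} : Finset ℕ)).card ≤ 3 := by
    intro a b c
    refine (Finset.card_union_le _ _).trans ?_
    have := Finset.card_union_le ({a} : Finset ℕ) {b}
    simp only [Finset.card_singleton] at this ⊢
    omega
  by_cases hA : ∀ z, C.D.pos z ∉ extr K₂ → z = u ∨ z = v ∨ z = w
  · left
    refine ⟨?_, hA⟩
    cases hp : p₂ with
    | nil => exact absurd rfl huw
    | cons h rest =>
      rename_i t
      have ht : t ∈ p₂.support := by rw [hp]; simp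
      rcases hA t (hX2A t (Or.inl ht)) with h' | h' | h'
      · exact absurd h'.symm h.ne
      · exact absurd (h' ▸ ht) hvp₂
      · rw [← h']; exact h
  right
  push Not at hA
  obtain ⟨y, hyA, hyu, hyv, hyw⟩ := hA
  obtain ⟨c1, hc1L, hc1⟩ := sub_color C hmin
    {z | C.D.pos z ∉ extr K₂ ∧ ¬ (z = u ∨ z = v ∨ z = w)}
    (fun z hz h => h.2 (hPA z hz h.1)) y ⟨hyA, by tauto⟩
  obtain ⟨x, hxu, hxv, hxw, hLx⟩ : ∃ x, (innerG C.D K₂).Adj x u ∧ (innerG C.D K₂).Adj x v ∧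
      (innerG C.D K₂).Adj x w ∧ C.L x = {c1 u} ∪ {c1 v} ∪ {c1 w} := by
    by_contra! hvi
    obtain ⟨c2, h1, h2, h3, h4, h5⟩ := ext_color C hmin p₂ hp₂ hvp₂ huv hvw huw hK₂def hPA
      (hmiss p₂ fun _ h => h) c1
      (fun z z' hz hz' h => hc1 z z' h (fun hh => hh.2 hz) (fun hh => hh.2 hz')) hvi
    exact hfinal c1 c2 hc1L (fun z z' h hz hz' => hc1 z z' h
      (fun hh => hz.elim hh.1 hh.2) (fun hh => hz'.elim hh.1 hh.2)) h1 h2 h3 h4 h5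
  have hxA : C.D.pos x ∉ extr K₂ := innerG_left hxu
  have hxuvw : ¬ (x = u ∨ x = v ∨ x = w) := by
    rintro (h | h | h)
    · exact hxu.ne h
    · exact hxv.ne h
    · exact hxw.ne h
  have hx3 : (C.L x).card = 3 :=
    le_antisymm (by rw [hLx]; exact hcard3 _ _ _) (hin3 x hxA hxuvw)
  refine ⟨x, hxu.1, hxv.1, hxw.1, hx3, ?_⟩
  by_contra! hA2
  obtain ⟨y2, hy2A, hy2u, hy2v, hy2w, hy2x⟩ := hA2
  have hxout : C.D.OnOuter x := by
    by_contra h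
    have := C.size5 x h
    omega
  have hxp : x ∈ p₂.support := by
    have : x ∈ cX v p₂ := by
      by_contra h
      exact hxA (Drawing.outer_not_in hxout fun h' => h (Drawing.pos_mem_pts (cSat _ _) h'))
    rcases this with h | h
    · exact h
    · exact absurd h hxv.ne
  obtain ⟨c0, hc0L, hc0⟩ := sub_color C hmin
    {z | C.D.pos z ∉ extr K₂ ∧ ¬ (z = u ∨ z = v ∨ z = w ∨ z = x)}
    (fun z hz h => h.2 (by rcases hPA z hz h.1 with h | h | h <;> tauto)) y2 ⟨hy2A, by tauto⟩
  obtain ⟨qa, qb, hqa, hqb, hqsup, hqe, hqi⟩ := path_split p₂ hp₂ hxp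
  have hext : ∀ {a c : Fin C.n} (q : C.G.Walk a c), q.IsPath →
      (∀ z ∈ q.support, z ∈ p₂.support) → (∀ e ∈ q.edges, e ∈ p₂.edges) →
      (hav : C.G.Adj a v) → (hvc : C.G.Adj v c) → a ≠ c → (x = a ∨ x = c) →
      (∀ z ∈ q.support, (z = u ∨ z = w) → (z = a ∨ z = c)) →
      (∀ z, (z = a ∨ z = v ∨ z = c) → (z = u ∨ z = v ∨ z = w ∨ z = x)) →
      ∃ c2 : Fin C.n → ℕ,
        (∀ z z', (innerG C.D (C.D.pts (cX v q) (cE v q))).Adj z z' → c2 z ≠ c2 z') ∧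
        (∀ z, C.D.pos z ∉ extr (C.D.pts (cX v q) (cE v q)) → z ≠ a → z ≠ v → z ≠ c →
          c2 z ∈ C.L z) ∧ c2 a = c0 a ∧ c2 v = c0 v ∧ c2 c = c0 c := by
    intro a c q hq hqs hqed hav hvc hac hxac hends hac4
    have hPq : ∀ z ∈ C.P.support, C.D.pos z ∉ extr (C.D.pts (cX v q) (cE v q)) →
        z = a ∨ z = v ∨ z = c := by
      intro z hz hzA
      have hzX : z ∈ cX v q := by
        by_contra h
        exact hzA (Drawing.outer_not_in (hPout z hz) fun h' =>
          h (Drawing.pos_mem_pts (cSat _ _) h'))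
      rcases hzX with hzq | hzv
      · rcases hPA z hz (hX2A z (Or.inl (hqs z hzq))) with h | h | h
        · rcases hends z hzq (Or.inl h) with h | h <;> tauto
        · tauto
        · rcases hends z hzq (Or.inr h) with h | h <;> tauto
      · tauto
    refine ext_color C hmin q hq (fun h => hvp₂ (hqs v h)) hav hvc hac rfl hPq (hmiss q hqed) c0
      (fun z z' hz hz' h => hc0 z z' h (fun hh => hh.2 (hac4 z hz)) (fun hh => hh.2 (hac4 z' hz')))
      ?_
    intro y' h1 h2 h3 hLy
    have hle : (C.L y').card ≤ 3 := by rw [hLy]; exact hcard3 _ _ _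
    have hy'P : y' ∉ C.P.support := by
      intro h
      rcases hPq y' h (innerG_left h1) with h | h | h
      · exact h1.ne h
      · exact h2.ne h
      · exact h3.ne h
    have hge : 3 ≤ (C.L y').card := by
      by_cases h : C.D.OnOuter y'
      · exact C.size3 y' h hy'P
      · exact le_trans (by norm_num) (C.size5 y' h)
    have hadj : C.G.Adj y' x := by
      rcases hxac with h | h
      · rw [h]; exact h1.1
      · rw [h]; exact h3.1
    exact C.no_adjacent_3 y' x hadj (le_antisymm hle hge) hx3
  have hux : u ≠ x := fun h => hxuvw (Or.inl h.symm)
  have hwx : w ≠ x := fun h => hxuvw (Or.inr (Or.inr h.symm))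
  have hwqa : w ∉ qa.support := fun h => hwx (hqi w h (by simp))
  have huqb : u ∉ qb.support := fun h => hux (hqi u (by simp) h)
  obtain ⟨ca, ha1, ha2, ha3, ha4, ha5⟩ := hext qa hqa (fun z hz => (hqsup z).2 (Or.inl hz))
    (fun e he => (hqe e).2 (Or.inl he)) huv hxv.1.symm hux (Or.inr rfl)
    (by rintro z hz (h | h)
        · exact Or.inl h
        · exact absurd (h ▸ hz) hwqa)
    (by rintro z (h | h | h) <;> tauto)
  obtain ⟨cb, hb1, hb2, hb3, hb4, hb5⟩ := hext qb hqb (fun z hz => (hqsup z).2 (Or.inr hz))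
    (fun e he => (hqe e).2 (Or.inr he)) hxv.1 hvw hwx.symm (Or.inl rfl)
    (by rintro z hz (h | h)
        · exact absurd (h ▸ hz) huqb
        · exact Or.inr h)
    (by rintro z (h | h | h) <;> tauto)
  set Ka := C.D.pts (cX v qa) (cE v qa) with hKa
  set Kb := C.D.pts (cX v qb) (cE v qb) with hKb
  have hXab : ∀ z, z ∈ cX v qa → z ∈ cX v qb → z = x ∨ z = v := by
    rintro z (h1 | h1) (h2 | h2)
    · exact Or.inl (hqi z h1 h2)
    · exact Or.inr h2
    · exact Or.inr h1
    · exact Or.inr h1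
  have hKab : K₂ ⊆ Ka ∪ Kb := by
    rintro p (⟨z, hz | hz, rfl⟩ | ⟨a, b, h, he | he | he, hp⟩)
    · rcases (hqsup z).1 hz with h | h
      · exact Or.inl (Or.inl ⟨z, Or.inl h, rfl⟩)
      · exact Or.inr (Or.inl ⟨z, Or.inl h, rfl⟩)
    · exact Or.inl (Or.inl ⟨z, Or.inr hz, rfl⟩)
    · rcases (hqe _).1 he with h' | h'
      · exact Or.inl (Or.inr ⟨a, b, h, Or.inl h', hp⟩)
      · exact Or.inr (Or.inr ⟨a, b, h, Or.inl h', hp⟩)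
    · exact Or.inl (Or.inr ⟨a, b, h, Or.inr (Or.inl he), hp⟩)
    · exact Or.inr (Or.inr ⟨a, b, h, Or.inr (Or.inr he), hp⟩)
  have hconnab : IsPreconnected (Ka ∩ Kb) := by
    rw [hKa, hKb, Drawing.pts_inter C.plane (cSat _ _) (cSat _ _)]
    apply preconnected_one C.D hxv.1
    · rintro z ⟨h1, h2⟩
      exact hXab z h1 h2
    · rintro e ⟨h1, h2⟩ z hz
      exact ⟨cSat _ _ _ h1 _ hz, cSat _ _ _ h2 _ hz⟩
    · exact ⟨Or.inr (Or.inr Sym2.eq_swap), Or.inr (Or.inl rfl)⟩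
  have hinA : ∀ z ∈ cX v qa, C.D.pos z ∉ extr Ka := fun z hz h => h.1 (Or.inl ⟨z, hz, rfl⟩)
  have huA : C.D.pos u ∉ extr Ka := hinA u (Or.inl (by simp))
  have hvA : C.D.pos v ∉ extr Ka := hinA v (Or.inr rfl)
  have hwA : ¬ C.D.pos w ∉ extr Ka := by
    refine not_not.2 (Drawing.outer_not_in (hFout w hw) fun h' => ?_)
    rcases Drawing.pos_mem_pts (cSat _ _) h' with h | h
    · exact hwqa h
    · exact hvw.ne h.symm
  refine hfinal c0 (fun z => if C.D.pos z ∉ extr Ka then ca z else cb z) hc0L ?_ ?_ ?_ ?_ ?_ ?_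
  · intro z z' h hz hz'
    refine hc0 z z' h (fun hh => ?_) (fun hh => ?_)
    · rcases hz with h | h
      · exact hh.1 h
      · exact hh.2 (by tauto)
    · rcases hz' with h | h
      · exact hh.1 h
      · exact hh.2 (by tauto)
  · intro z z' h
    refine glue_color (S := {z | z = x ∨ z = v}) C.plane (cSat v qa) (cSat v qb) ?_ cb ca ?_
      (fun z z' h _ _ => hb1 z z' h) ha1 ?_
    · intro z hz hzS
      refine ⟨?_, fun h1 => hzS (hXab z hz h1)⟩
      rcases hz with hz | hz
      · exact hFout z (hp₂F z ((hqsup z).2 (Or.inl hz)))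
      · exact absurd (Or.inr hz) hzS
    · rintro z (rfl | rfl)
      · rw [ha5, hb3]
      · rw [ha4, hb4]
    · rcases Drawing.edge_split C.plane hKab hconnab h.1 h.2 with h' | h'
      · exact Or.inr ⟨h.1, h'⟩
      · exact Or.inl ⟨h.1, h'⟩
  · intro z hz hzu hzv hzw
    show (if C.D.pos z ∉ extr Ka then ca z else cb z) ∈ C.L z
    by_cases hza : C.D.pos z ∉ extr Ka
    · rw [if_pos hza]
      by_cases hzx : z = x
      · rw [hzx, ha5]; exact hc0L x
      · exact ha2 z hza hzu hzv hzx
    · rw [if_neg hza]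
      have hzb := (Drawing.vertex_split hKab hconnab hz).resolve_left hza
      by_cases hzx : z = x
      · rw [hzx, hb3]; exact hc0L x
      · exact hb2 z hzb hzx hzv hzw
  · show (if C.D.pos u ∉ extr Ka then ca u else cb u) = c0 u
    rw [if_pos huA, ha3]
  · show (if C.D.pos v ∉ extr Ka then ca v else cb v) = c0 v
    rw [if_pos hvA, ha4]
  · show (if C.D.pos w ∉ extr Ka then ca w else cb w) = c0 w
    rw [if_neg hwA, hb5]
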